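/- (Multilinear Hardy–Littlewood–Sobolev trace inequality.) Let m,n ≥ 1, let 0 < α_k < n for k = 1,…,m, set α = Σ α_k, assume (m−1)n < α < mn, and let q = 2n/(mn−α) (so 2 < q < ∞). Then for every f ∈ 𝒮(ℝ^{mn}), (∫_{ℝ^n} |f(x,…,x)|^q dx)^{2/q} ≤ F_α · Λ(f; α_1,…,α_m), where F_α = π^{α/2} · Π_{k=1}^m [Γ((n−α_k)/2)/Γ(α_k/2)] · [Γ((α−(m−1)n)/2) / Γ(n − (mn−α)/2)] · [Γ(n)/Γ(n/2)]^{(α−(m−1)n)/n}. Moreover, F_α is the least constant for which this inequality holds for all Schwartz f. -/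

import Mathlib

open MeasureTheory Real
open scoped ENNReal InnerProductSpace

noncomputable section

/-- Fourier transform with kernel `e^{2πi x·ξ}` on `(ℝ^n)^m`. -/
def fourierM {m n : ℕ} (f : (Fin m → EuclideanSpace ℝ (Fin n)) → ℂ)
    (ξ : Fin m → EuclideanSpace ℝ (Fin n)) : ℂ :=
  ∫ x, Complex.exp (2 * Real.pi * Complex.I * ((∑ k, ⟪x k, ξ k⟫_ℝ : ℝ) : ℂ)) * f x

/-- The multilinear fractional Dirichlet form
`Λ(f; α_1, …, α_m) = ∫ Π_k |ξ_k|^{α_k} |f̂(ξ)|² dξ`. -/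
def LamM {m n : ℕ} (f : (Fin m → EuclideanSpace ℝ (Fin n)) → ℂ)
    (α : Fin m → ℝ) : ℝ≥0∞ :=
  ∫⁻ ξ, (∏ k, ENNReal.ofReal (‖ξ k‖ ^ α k)) * (‖fourierM f ξ‖₊ : ℝ≥0∞) ^ (2 : ℕ)

set_option linter.unusedSectionVars false

section Polarizations

open EuclideanGeometry (inversion)

section Inversion

variable {E : Type*} [NormedAddCommGroup E] [InnerProductSpace ℝ E]

theorem norm_inversion_sub_center {a : E} {r : ℝ} (x : E) :
    ‖inversion a r x - a‖ = r ^ 2 / ‖x - a‖ := by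
  simpa [dist_eq_norm] using EuclideanGeometry.dist_inversion_center a x r

theorem norm_sub_inversion_sq {a y : E} {r : ℝ} (hy : y ≠ a) (x : E) :
    ‖x - inversion a r y‖ ^ 2 - (r / ‖y - a‖) ^ 2 * ‖x - y‖ ^ 2 =
      (‖x - a‖ ^ 2 - r ^ 2) * (1 - (r / ‖y - a‖) ^ 2) := by
  have hy' : ‖y - a‖ ≠ 0 := norm_ne_zero_iff.2 (sub_ne_zero.2 hy)
  have e1 : x - inversion a r y = (x - a) - (r / ‖y - a‖) ^ 2 • (y - a) := by
    simp only [inversion, dist_eq_norm, vsub_eq_sub, vadd_eq_add]; abel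
  have e2 : x - y = (x - a) - (y - a) := by abel
  rw [e1, e2]
  generalize x - a = u at *
  generalize y - a = v at *
  rw [norm_sub_sq_real, norm_sub_sq_real, inner_smul_right, norm_smul, Real.norm_eq_abs,
    abs_of_nonneg (sq_nonneg _)]
  field_simp
  ring

theorem one_add_norm_inversion_sq {a x : E} {r : ℝ} (hx : x ≠ a) :
    1 + ‖inversion a r x‖ ^ 2 - (r / ‖x - a‖) ^ 2 * (1 + ‖x‖ ^ 2) =
      (1 + ‖a‖ ^ 2 - r ^ 2) * (1 - (r / ‖x - a‖) ^ 2) := by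
  have h := norm_sub_inversion_sq (r := r) hx 0
  simp only [zero_sub, norm_neg] at h
  linear_combination h

theorem div_norm_inversion_sub_center {a x : E} {r : ℝ} (hr : 0 < r) (hx : x ≠ a) :
    r / ‖inversion a r x - a‖ = (r / ‖x - a‖)⁻¹ := by
  have hx' : ‖x - a‖ ≠ 0 := norm_ne_zero_iff.2 (sub_ne_zero.2 hx)
  rw [norm_inversion_sub_center]
  field_simp

theorem inversion_ne_center {a x : E} {r : ℝ} (hr : 0 < r) (hx : x ≠ a) : inversion a r x ≠ a :=
  fun h => hx ((EuclideanGeometry.inversion_eq_center hr.ne').1 h)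

/-- The pullback of `f` under the inversion in the sphere of centre `a` and radius `r`, with
conformal weight `e`. -/
def conformalPullback (e : ℝ) (a : E) (r : ℝ) (f : E → ℝ≥0∞) (x : E) : ℝ≥0∞ :=
  ENNReal.ofReal ((r / ‖x - a‖) ^ e) * f (inversion a r x)

theorem conformalPullback_mul {e e' r : ℝ} {a x : E} (hr : 0 < r) (hx : x ≠ a)
    (f g : E → ℝ≥0∞) :
    conformalPullback e a r f x * conformalPullback e' a r g x =
      conformalPullback (e + e') a r (fun y => f y * g y) x := by
  have hx' : 0 < ‖x - a‖ := norm_pos_iff.2 (sub_ne_zero.2 hx)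
  unfold conformalPullback
  rw [Real.rpow_add (by positivity), ENNReal.ofReal_mul (by positivity)]
  ring

theorem conformalPullback_rpow {e r p : ℝ} {a x : E} (hr : 0 < r) (hp : 0 ≤ p)
    (f : E → ℝ≥0∞) :
    conformalPullback e a r f x ^ p = conformalPullback (e * p) a r (fun y => f y ^ p) x := by
  unfold conformalPullback
  rw [ENNReal.mul_rpow_of_nonneg _ _ hp, ENNReal.ofReal_rpow_of_nonneg (by positivity) hp,
    ← Real.rpow_mul (by positivity)]

theorem conformalPullback_conformalPullback {e r : ℝ} {a x : E} (hr : 0 < r) (hx : x ≠ a)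
    (f : E → ℝ≥0∞) :
    conformalPullback e a r (conformalPullback e a r f) x = f x := by
  have hx' : 0 < ‖x - a‖ := norm_pos_iff.2 (sub_ne_zero.2 hx)
  unfold conformalPullback
  rw [div_norm_inversion_sub_center hr hx, EuclideanGeometry.inversion_inversion _ hr.ne',
    ← mul_assoc, ← ENNReal.ofReal_mul (by positivity), Real.inv_rpow (by positivity),
    mul_inv_cancel₀ (by positivity)]
  simp

theorem conformalPullback_mono {e r : ℝ} {a : E} {f g : E → ℝ≥0∞} (h : ∀ x, f x ≤ g x) (x : E) :
    conformalPullback e a r f x ≤ conformalPullback e a r g x := by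
  unfold conformalPullback
  gcongr
  exact h _

section Measure

variable [MeasurableSpace E] [BorelSpace E] [FiniteDimensional ℝ E]

theorem measurable_inversion (a : E) (r : ℝ) : Measurable (inversion a r) := by
  simp only [EuclideanGeometry.inversion_def, dist_eq_norm, vsub_eq_sub, vadd_eq_add]
  fun_prop

theorem Measurable.conformalPullback {e r : ℝ} {a : E} {f : E → ℝ≥0∞} (hf : Measurable f) :
    Measurable (conformalPullback e a r f) := by
  have := measurable_inversion a r
  unfold _root_.conformalPullback
  fun_prop

theorem abs_det_smul_reflection (c : ℝ) (K : Submodule ℝ E) :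
    |(c • (K.reflection : E →L[ℝ] E)).det| = |c| ^ Module.finrank ℝ E := by
  have h : ((K.reflection : E →L[ℝ] E) : E →ₗ[ℝ] E).det *
      ((K.reflection : E →L[ℝ] E) : E →ₗ[ℝ] E).det = 1 := by
    rw [← LinearMap.det_comp, ← LinearMap.det_id (A := ℝ) (M := E)]
    congr 1
    ext x
    simp
  have h1 : |((K.reflection : E →L[ℝ] E) : E →ₗ[ℝ] E).det| = 1 := by
    rcases mul_self_eq_one_iff.1 h with h | h
    · rw [h, abs_one]
    · rw [h, abs_neg, abs_one]
  rw [ContinuousLinearMap.det, ContinuousLinearMap.toLinearMap_smul, LinearMap.det_smul, abs_mul,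
    h1, mul_one, abs_pow]

theorem lintegral_conformalPullback [Nontrivial E] {a : E} {r : ℝ} (hr : 0 < r)
    (f : E → ℝ≥0∞) :
    ∫⁻ x, conformalPullback (2 * (Module.finrank ℝ E : ℝ)) a r f x = ∫⁻ x, f x := by
  have hc : ({a}ᶜ : Set E) =ᵐ[volume] Set.univ := by
    rw [ae_eq_univ]; simp
  have himg : inversion a r '' {a}ᶜ = {a}ᶜ := by
    ext y
    constructor
    · rintro ⟨x, hx, rfl⟩; exact inversion_ne_center hr hx
    · intro hy
      exact ⟨inversion a r y, inversion_ne_center hr hy,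
        EuclideanGeometry.inversion_inversion _ hr.ne' _⟩
  have key := lintegral_image_eq_lintegral_abs_det_fderiv_mul (volume : Measure E)
    (s := {a}ᶜ) (f := inversion a r) (MeasurableSet.singleton a).compl
    (fun x hx => (EuclideanGeometry.hasFDerivAt_inversion (R := r) hx).hasFDerivWithinAt)
    ((EuclideanGeometry.inversion_injective a hr.ne').injOn) f
  rw [himg, setLIntegral_congr hc, setLIntegral_congr hc, setLIntegral_univ, setLIntegral_univ]
    at key
  rw [key]
  congr 1 with x
  unfold conformalPullback
  rw [abs_det_smul_reflection, dist_eq_norm, abs_of_nonneg (sq_nonneg _), ← pow_mul,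
    ← Real.rpow_natCast]
  push_cast
  rfl

end Measure
end Inversion

section Riesz

/-- The Riesz kernel `t ↦ t ^ (-l)`, with value `∞` at `0`. -/
def rieszKernel (l t : ℝ) : ℝ≥0∞ := (ENNReal.ofReal (t ^ l))⁻¹

theorem measurable_rieszKernel (l : ℝ) : Measurable (rieszKernel l) := by
  unfold rieszKernel
  fun_prop

theorem rieszKernel_anti {l s t : ℝ} (hl : 0 ≤ l) (hs : 0 ≤ s) (hst : s ≤ t) :
    rieszKernel l t ≤ rieszKernel l s := by
  unfold rieszKernel
  gcongr

theorem ofReal_rpow_mul_rieszKernel {l c t : ℝ} (hc : 0 < c) (ht : 0 ≤ t) :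
    ENNReal.ofReal (c ^ l) * rieszKernel l (c * t) = rieszKernel l t := by
  unfold rieszKernel
  have h : ENNReal.ofReal (c ^ l) ≠ 0 := by
    rw [ENNReal.ofReal_ne_zero_iff]; positivity
  rw [Real.mul_rpow hc.le ht, ENNReal.ofReal_mul (by positivity),
    ENNReal.mul_inv (Or.inl h) (Or.inl ENNReal.ofReal_ne_top), ← mul_assoc,
    ENNReal.mul_inv_cancel h ENNReal.ofReal_ne_top, one_mul]

variable {E : Type*} [NormedAddCommGroup E] [InnerProductSpace ℝ E]

/-- The Riesz kernel with the second point reflected in the sphere of centre `a`, radius `r`. -/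
def reflectedKernel (l : ℝ) (a : E) (r : ℝ) (x y : E) : ℝ≥0∞ :=
  rieszKernel l (‖x - inversion a r y‖ / (r / ‖y - a‖))

theorem conformalPullback_rieszKernel {l r : ℝ} {a y : E} (hr : 0 < r) (hy : y ≠ a) (x : E) :
    conformalPullback l a r (fun z => rieszKernel l ‖x - z‖) y = reflectedKernel l a r x y := by
  have hy' : 0 < ‖y - a‖ := norm_pos_iff.2 (sub_ne_zero.2 hy)
  have hc : 0 < r / ‖y - a‖ := by positivity
  have key := ofReal_rpow_mul_rieszKernel (l := l) hc
    (div_nonneg (norm_nonneg (x - inversion a r y)) hc.le)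
  rwa [mul_div_cancel₀ _ hc.ne'] at key

theorem norm_inversion_sub_inversion {a x y : E} {r : ℝ} (hx : x ≠ a) (hy : y ≠ a) :
    ‖inversion a r x - inversion a r y‖ = (r / ‖x - a‖) * ((r / ‖y - a‖) * ‖x - y‖) := by
  have := EuclideanGeometry.dist_inversion_inversion hx hy r
  simp only [dist_eq_norm] at this
  rw [this]
  ring

theorem ofReal_mul_reflectedKernel_inversion {l r : ℝ} {a x y : E} (hr : 0 < r) (hx : x ≠ a)
    (hy : y ≠ a) :
    ENNReal.ofReal ((r / ‖x - a‖) ^ l) * reflectedKernel l a r (inversion a r x) y =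
      rieszKernel l ‖x - y‖ := by
  have hx' : 0 < ‖x - a‖ := norm_pos_iff.2 (sub_ne_zero.2 hx)
  have hy' : 0 < ‖y - a‖ := norm_pos_iff.2 (sub_ne_zero.2 hy)
  unfold reflectedKernel
  rw [norm_inversion_sub_inversion hx hy,
    ← ofReal_rpow_mul_rieszKernel (c := r / ‖x - a‖) (by positivity) (norm_nonneg (x - y))]
  congr 2
  field_simp

theorem ofReal_mul_rieszKernel_inversion {l r : ℝ} {a x y : E} (hr : 0 < r) (hx : x ≠ a)
    (hy : y ≠ a) :
    ENNReal.ofReal ((r / ‖x - a‖) ^ l) * rieszKernel l ‖inversion a r x - y‖ =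
      reflectedKernel l a r x y := by
  have hx' : 0 < ‖x - a‖ := norm_pos_iff.2 (sub_ne_zero.2 hx)
  have hy' : 0 < ‖y - a‖ := norm_pos_iff.2 (sub_ne_zero.2 hy)
  have key := EuclideanGeometry.dist_inversion_mul_dist_center_eq (R := r) hx hy
  simp only [dist_eq_norm] at key
  unfold reflectedKernel
  rw [← ofReal_rpow_mul_rieszKernel (c := r / ‖x - a‖) (by positivity)
    (t := ‖x - inversion a r y‖ / (r / ‖y - a‖)) (by positivity)]
  congr 2
  field_simp
  linarith

/-- The side of the sphere of centre `a` and radius `r` on which the standard bubble dominates its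
pullback under the inversion. -/
def polarSide (a : E) (r : ℝ) : Set E := {x | 0 ≤ (1 + ‖a‖ ^ 2 - r ^ 2) * (‖x - a‖ - r)}

theorem one_sub_div_sq_eq {a y : E} {r : ℝ} (hy : y ≠ a) :
    1 - (r / ‖y - a‖) ^ 2 = (‖y - a‖ - r) * ((‖y - a‖ + r) / ‖y - a‖ ^ 2) := by
  have hy' : ‖y - a‖ ≠ 0 := norm_ne_zero_iff.2 (sub_ne_zero.2 hy)
  field_simp
  ring

theorem reflectedKernel_le {l r : ℝ} {a x y : E} (hl : 0 ≤ l) (hr : 0 < r) (hy : y ≠ a)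
    (h : 0 ≤ (‖x - a‖ - r) * (‖y - a‖ - r)) :
    reflectedKernel l a r x y ≤ rieszKernel l ‖x - y‖ := by
  have hy' : 0 < ‖y - a‖ := norm_pos_iff.2 (sub_ne_zero.2 hy)
  refine rieszKernel_anti hl (norm_nonneg _) ?_
  rw [le_div_iff₀ (by positivity), mul_comm]
  refine abs_le_of_sq_le_sq' ?_ (norm_nonneg _) |>.2
  have key := norm_sub_inversion_sq (r := r) hy x
  have : 0 ≤ (‖x - a‖ ^ 2 - r ^ 2) * (1 - (r / ‖y - a‖) ^ 2) := by
    rw [one_sub_div_sq_eq hy]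
    have := mul_nonneg h (show 0 ≤ (‖x - a‖ + r) * ((‖y - a‖ + r) / ‖y - a‖ ^ 2) by positivity)
    linarith
  rw [mul_pow]
  linarith

theorem rieszKernel_le_reflectedKernel {l r : ℝ} {a x y : E} (hl : 0 ≤ l) (hr : 0 < r)
    (hy : y ≠ a) (h : (‖x - a‖ - r) * (‖y - a‖ - r) ≤ 0) :
    rieszKernel l ‖x - y‖ ≤ reflectedKernel l a r x y := by
  have hy' : 0 < ‖y - a‖ := norm_pos_iff.2 (sub_ne_zero.2 hy)
  refine rieszKernel_anti hl (by positivity) ?_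
  rw [div_le_iff₀ (by positivity), mul_comm]
  refine abs_le_of_sq_le_sq' ?_ (by positivity) |>.2
  have key := norm_sub_inversion_sq (r := r) hy x
  have : (‖x - a‖ ^ 2 - r ^ 2) * (1 - (r / ‖y - a‖) ^ 2) ≤ 0 := by
    rw [one_sub_div_sq_eq hy]
    have := mul_nonneg (neg_nonneg.2 h)
      (show 0 ≤ (‖x - a‖ + r) * ((‖y - a‖ + r) / ‖y - a‖ ^ 2) by positivity)
    linarith
  rw [mul_pow]
  linarith

theorem reflectedKernel_le_of_mem_iff {l r : ℝ} {a x y : E} (hl : 0 ≤ l) (hr : 0 < r)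
    (hd : 1 + ‖a‖ ^ 2 - r ^ 2 ≠ 0) (hy : y ≠ a) (h : x ∈ polarSide a r ↔ y ∈ polarSide a r) :
    reflectedKernel l a r x y ≤ rieszKernel l ‖x - y‖ := by
  refine reflectedKernel_le hl hr hy ?_
  simp only [polarSide, Set.mem_ofPred_eq] at h
  have h2 : 0 < (1 + ‖a‖ ^ 2 - r ^ 2) ^ 2 := by positivity
  refine nonneg_of_mul_nonneg_right ?_ h2
  by_cases hx : 0 ≤ (1 + ‖a‖ ^ 2 - r ^ 2) * (‖x - a‖ - r)
  · have := mul_nonneg hx (h.1 hx); linarith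
  · have hy : ¬ 0 ≤ (1 + ‖a‖ ^ 2 - r ^ 2) * (‖y - a‖ - r) := fun hy => hx (h.2 hy)
    have := mul_nonneg (neg_nonneg.2 (not_le.1 hx).le) (neg_nonneg.2 (not_le.1 hy).le); linarith

theorem rieszKernel_le_of_not_mem_iff {l r : ℝ} {a x y : E} (hl : 0 ≤ l) (hr : 0 < r)
    (hd : 1 + ‖a‖ ^ 2 - r ^ 2 ≠ 0) (hy : y ≠ a) (h : ¬ (x ∈ polarSide a r ↔ y ∈ polarSide a r)) :
    rieszKernel l ‖x - y‖ ≤ reflectedKernel l a r x y := by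
  refine rieszKernel_le_reflectedKernel hl hr hy ?_
  simp only [polarSide, Set.mem_ofPred_eq] at h
  have h2 : 0 < (1 + ‖a‖ ^ 2 - r ^ 2) ^ 2 := by positivity
  refine nonpos_of_mul_nonpos_right ?_ h2
  by_cases hx : 0 ≤ (1 + ‖a‖ ^ 2 - r ^ 2) * (‖x - a‖ - r)
  · have hy : ¬ 0 ≤ (1 + ‖a‖ ^ 2 - r ^ 2) * (‖y - a‖ - r) := fun hy => h (by tauto)
    have := mul_nonneg hx (neg_nonneg.2 (not_le.1 hy).le); linarith
  · have hy : 0 ≤ (1 + ‖a‖ ^ 2 - r ^ 2) * (‖y - a‖ - r) := by by_contra hy; exact h (by tauto)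
    have := mul_nonneg (neg_nonneg.2 (not_le.1 hx).le) hy; linarith

/-- The function `(1 + |x|²) ^ (-e/2)`. -/
def bubble (e : ℝ) (x : E) : ℝ≥0∞ := ENNReal.ofReal ((1 + ‖x‖ ^ 2) ^ (-(e / 2)))

theorem bubble_ne_zero (e : ℝ) (x : E) : bubble e x ≠ 0 := by
  unfold bubble; rw [ENNReal.ofReal_ne_zero_iff]; positivity

theorem bubble_ne_top (e : ℝ) (x : E) : bubble e x ≠ ∞ := ENNReal.ofReal_ne_top

theorem bubble_zero (e : ℝ) : bubble e (0 : E) = 1 := by simp [bubble]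

theorem bubble_mul (e e' : ℝ) (x : E) : bubble e x * bubble e' x = bubble (e + e') x := by
  unfold bubble
  rw [← ENNReal.ofReal_mul (by positivity), ← Real.rpow_add (by positivity)]
  congr 2; ring

theorem bubble_rpow (e p : ℝ) (hp : 0 ≤ p) (x : E) : bubble e x ^ p = bubble (e * p) x := by
  unfold bubble
  rw [ENNReal.ofReal_rpow_of_nonneg (by positivity) hp, ← Real.rpow_mul (by positivity)]
  congr 2; ring

theorem conformalPullback_bubble_eq {e r : ℝ} {a x : E} (hr : 0 < r) (hx : x ≠ a) :
    conformalPullback e a r (bubble e) x =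
      ENNReal.ofReal (((1 + ‖inversion a r x‖ ^ 2) / (r / ‖x - a‖) ^ 2) ^ (-(e / 2))) := by
  have hx' : 0 < ‖x - a‖ := norm_pos_iff.2 (sub_ne_zero.2 hx)
  unfold bubble conformalPullback
  have hc : 0 < r / ‖x - a‖ := by positivity
  generalize r / ‖x - a‖ = c at *
  rw [← ENNReal.ofReal_mul (by positivity), Real.div_rpow (by positivity) (by positivity),
    ← Real.rpow_natCast c, ← Real.rpow_mul (by positivity),
    show ((2 : ℕ) : ℝ) * -(e / 2) = -e by push_cast; ring, Real.rpow_neg hc.le, div_inv_eq_mul,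
    mul_comm]

theorem conformalPullback_bubble_of_eq {e r : ℝ} {a x : E} (hr : 0 < r) (hx : x ≠ a)
    (hd : r ^ 2 = 1 + ‖a‖ ^ 2) :
    conformalPullback e a r (bubble e) x = bubble e x := by
  have hx' : 0 < ‖x - a‖ := norm_pos_iff.2 (sub_ne_zero.2 hx)
  rw [conformalPullback_bubble_eq hr hx, bubble]
  congr 2
  have := one_add_norm_inversion_sq (r := r) hx
  rw [div_eq_iff (by positivity)]
  rw [hd] at this
  linarith

theorem conformalPullback_bubble_le {e r : ℝ} {a x : E} (he : 0 ≤ e) (hr : 0 < r) (hx : x ≠ a)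
    (h : x ∈ polarSide a r) :
    conformalPullback e a r (bubble e) x ≤ bubble e x := by
  have hx' : 0 < ‖x - a‖ := norm_pos_iff.2 (sub_ne_zero.2 hx)
  rw [conformalPullback_bubble_eq hr hx, bubble]
  refine ENNReal.ofReal_le_ofReal (Real.rpow_le_rpow_of_nonpos (by positivity) ?_ (by linarith))
  rw [le_div_iff₀ (by positivity)]
  have := one_add_norm_inversion_sq (r := r) hx
  rw [one_sub_div_sq_eq hx, ← mul_assoc] at this
  have h2 : 0 ≤ (1 + ‖a‖ ^ 2 - r ^ 2) * (‖x - a‖ - r) * ((‖x - a‖ + r) / ‖x - a‖ ^ 2) :=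
    mul_nonneg h (by positivity)
  linarith

theorem bubble_lt_conformalPullback {e r : ℝ} {a x : E} (he : 0 < e) (hr : 0 < r) (hx : x ≠ a)
    (h : x ∉ polarSide a r) :
    bubble e x < conformalPullback e a r (bubble e) x := by
  have hx' : 0 < ‖x - a‖ := norm_pos_iff.2 (sub_ne_zero.2 hx)
  rw [conformalPullback_bubble_eq hr hx, bubble]
  refine (ENNReal.ofReal_lt_ofReal_iff (by positivity)).2
    (Real.rpow_lt_rpow_of_neg (by positivity) ?_ (by linarith))
  rw [div_lt_iff₀ (by positivity)]
  have := one_add_norm_inversion_sq (r := r) hx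
  rw [one_sub_div_sq_eq hx, ← mul_assoc] at this
  have h2 : (1 + ‖a‖ ^ 2 - r ^ 2) * (‖x - a‖ - r) * ((‖x - a‖ + r) / ‖x - a‖ ^ 2) < 0 :=
    mul_neg_of_neg_of_pos (not_le.1 h) (by positivity)
  linarith

theorem conformalPullback_bubble_lt {e r : ℝ} {a x : E} (he : 0 < e) (hr : 0 < r) (hx : x ≠ a)
    (hd : 1 + ‖a‖ ^ 2 - r ^ 2 ≠ 0) (h : x ∈ polarSide a r) (hxr : ‖x - a‖ ≠ r) :
    conformalPullback e a r (bubble e) x < bubble e x := by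
  have hx' : 0 < ‖x - a‖ := norm_pos_iff.2 (sub_ne_zero.2 hx)
  rw [conformalPullback_bubble_eq hr hx, bubble]
  refine (ENNReal.ofReal_lt_ofReal_iff (by positivity)).2
    (Real.rpow_lt_rpow_of_neg (by positivity) ?_ (by linarith))
  rw [lt_div_iff₀ (by positivity)]
  have := one_add_norm_inversion_sq (r := r) hx
  rw [one_sub_div_sq_eq hx, ← mul_assoc] at this
  have h2 : 0 < (1 + ‖a‖ ^ 2 - r ^ 2) * (‖x - a‖ - r) * ((‖x - a‖ + r) / ‖x - a‖ ^ 2) :=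
    mul_pos (lt_of_le_of_ne h (Ne.symm (mul_ne_zero hd (sub_ne_zero.2 hxr)))) (by positivity)
  linarith

end Riesz

section Polarization

variable {E : Type*} [NormedAddCommGroup E] [InnerProductSpace ℝ E]

/-- The Riesz potential of `f`. -/
def rieszPotential [MeasureSpace E] (l : ℝ) (f : E → ℝ≥0∞) (x : E) : ℝ≥0∞ :=
  ∫⁻ y, f y * rieszKernel l ‖x - y‖

/-- The Riesz energy of `f`. -/
def rieszEnergy [MeasureSpace E] (l : ℝ) (f : E → ℝ≥0∞) : ℝ≥0∞ :=
  ∫⁻ x, f x * rieszPotential l f x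

/-- Polarization of `f` with respect to an inversion, with conformal weight `e`. -/
def polarize (e : ℝ) (a : E) (r : ℝ) (f : E → ℝ≥0∞) (x : E) : ℝ≥0∞ :=
  open Classical in
  if x ∈ polarSide a r then max (f x) (conformalPullback e a r f x)
  else min (f x) (conformalPullback e a r f x)

theorem conformalPullback_of_norm_eq {e r : ℝ} {a x : E} (hr : 0 < r) (hx : ‖x - a‖ = r)
    (f : E → ℝ≥0∞) : conformalPullback e a r f x = f x := by
  have h : inversion a r x = x :=
    EuclideanGeometry.inversion_of_mem_sphere (by simp [hx])
  simp [conformalPullback, h, hx, hr.ne']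

theorem inversion_mem_polarSide_iff {a x : E} {r : ℝ} (hr : 0 < r) (hx : x ≠ a)
    (hxr : ‖x - a‖ ≠ r) (hd : 1 + ‖a‖ ^ 2 - r ^ 2 ≠ 0) :
    inversion a r x ∈ polarSide a r ↔ x ∉ polarSide a r := by
  have hx' : 0 < ‖x - a‖ := norm_pos_iff.2 (sub_ne_zero.2 hx)
  simp only [polarSide, Set.mem_ofPred_eq, norm_inversion_sub_center, not_le]
  have h : (1 + ‖a‖ ^ 2 - r ^ 2) * (r ^ 2 / ‖x - a‖ - r) =
      -((1 + ‖a‖ ^ 2 - r ^ 2) * (‖x - a‖ - r) * (r / ‖x - a‖)) := by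
    field_simp
    ring
  have hc : 0 < r / ‖x - a‖ := by positivity
  have hne : (1 + ‖a‖ ^ 2 - r ^ 2) * (‖x - a‖ - r) ≠ 0 := mul_ne_zero hd (sub_ne_zero.2 hxr)
  rw [h, neg_nonneg]
  constructor
  · intro h1
    exact lt_of_le_of_ne (nonpos_of_mul_nonpos_left h1 hc) hne
  · intro h1
    exact (mul_neg_of_neg_of_pos h1 hc).le

theorem conformalPullback_polarize {e r : ℝ} {a x : E} (hr : 0 < r) (hx : x ≠ a)
    (hd : 1 + ‖a‖ ^ 2 - r ^ 2 ≠ 0) (f : E → ℝ≥0∞) :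
    conformalPullback e a r (polarize e a r f) x =
      open Classical in
      if x ∈ polarSide a r then min (f x) (conformalPullback e a r f x)
      else max (f x) (conformalPullback e a r f x) := by
  by_cases hxr : ‖x - a‖ = r
  · simp [conformalPullback_of_norm_eq hr hxr, polarize]
  · have hm := inversion_mem_polarSide_iff hr hx hxr hd
    have h1 : ENNReal.ofReal ((r / ‖x - a‖) ^ e) *
        conformalPullback e a r f (inversion a r x) = f x :=
      conformalPullback_conformalPullback hr hx f
    rw [conformalPullback, polarize]
    by_cases hxs : x ∈ polarSide a r
    · rw [if_neg (by tauto), if_pos hxs, mul_min, h1, min_comm, conformalPullback]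
    · rw [if_pos (by tauto), if_neg hxs, mul_max, h1, max_comm, conformalPullback]

variable [MeasurableSpace E] [BorelSpace E] [FiniteDimensional ℝ E]

theorem measurableSet_polarSide (a : E) (r : ℝ) : MeasurableSet (polarSide a r) :=
  measurableSet_le measurable_const (by fun_prop)

theorem Measurable.polarize {e r : ℝ} {a : E} {f : E → ℝ≥0∞} (hf : Measurable f) :
    Measurable (polarize e a r f) := by
  classical
  exact Measurable.ite (p := fun x => x ∈ polarSide a r) (measurableSet_polarSide a r)
    (hf.max hf.conformalPullback) (hf.min hf.conformalPullback)

theorem measurable_reflectedKernel_right (l : ℝ) (a : E) (r : ℝ) (x : E) :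
    Measurable (fun y : E => reflectedKernel l a r x y) := by
  have := measurable_inversion a r
  have := measurable_rieszKernel l
  unfold reflectedKernel
  fun_prop

theorem measurable_rieszKernel_norm (l : ℝ) :
    Measurable (fun p : E × E => rieszKernel l ‖p.1 - p.2‖) := by
  have := measurable_rieszKernel l
  fun_prop

theorem measurable_rieszKernel_norm_right (l : ℝ) (x : E) :
    Measurable (fun y : E => rieszKernel l ‖x - y‖) := by
  have := measurable_rieszKernel l
  fun_prop

theorem measurable_rieszPotential {l : ℝ} {f : E → ℝ≥0∞} (hf : Measurable f) :
    Measurable (rieszPotential l f) := by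
  have := measurable_rieszKernel_norm (E := E) l
  exact Measurable.lintegral_prod_right' (f := fun p : E × E => f p.2 * rieszKernel l ‖p.1 - p.2‖)
    (by fun_prop)

theorem measurable_bubble (e : ℝ) : Measurable (bubble e : E → ℝ≥0∞) := by
  unfold bubble; fun_prop

theorem rieszPotential_mono {l : ℝ} {f g : E → ℝ≥0∞} (h : ∀ x, f x ≤ g x) (x : E) :
    rieszPotential l f x ≤ rieszPotential l g x :=
  lintegral_mono fun y => mul_le_mul_left (h y) _

variable [Nontrivial E]

local notation "dim" => (Module.finrank ℝ E : ℝ)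

theorem ae_ne (a : E) : ∀ᵐ x : E, x ≠ a := by
  simp [ae_iff]

theorem lintegral_mul_conformalPullback {e e' r : ℝ} {a : E} (hr : 0 < r) (he : e + e' = 2 * dim)
    (f g : E → ℝ≥0∞) :
    ∫⁻ x, conformalPullback e a r f x * conformalPullback e' a r g x = ∫⁻ x, f x * g x := by
  rw [← lintegral_conformalPullback (a := a) hr (fun x => f x * g x), ← he]
  refine lintegral_congr_ae ?_
  filter_upwards [ae_ne a] with x hx
  exact conformalPullback_mul hr hx f g

theorem lintegral_rpow_conformalPullback {e p r : ℝ} {a : E} (hr : 0 < r) (hp : 0 ≤ p)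
    (he : e * p = 2 * dim) (f : E → ℝ≥0∞) :
    ∫⁻ x, conformalPullback e a r f x ^ p = ∫⁻ x, f x ^ p := by
  rw [← lintegral_conformalPullback (a := a) hr (fun x => f x ^ p), ← he]
  exact lintegral_congr fun x => conformalPullback_rpow hr hp f

theorem rieszPotential_eq_lintegral_reflectedKernel {l r : ℝ} {a : E} (hr : 0 < r)
    (f : E → ℝ≥0∞) (x : E) :
    rieszPotential l f x =
      ∫⁻ y, conformalPullback (2 * dim - l) a r f y * reflectedKernel l a r x y := by
  rw [rieszPotential, ← lintegral_mul_conformalPullback (a := a) hr (sub_add_cancel (2 * dim) l)]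
  refine lintegral_congr_ae ?_
  filter_upwards [ae_ne a] with y hy
  rw [conformalPullback_rieszKernel hr hy]

theorem conformalPullback_rieszPotential {l r : ℝ} {a x : E} (hr : 0 < r) (hx : x ≠ a)
    (f : E → ℝ≥0∞) :
    conformalPullback l a r (rieszPotential l f) x =
      rieszPotential l (conformalPullback (2 * dim - l) a r f) x := by
  rw [conformalPullback, rieszPotential_eq_lintegral_reflectedKernel (a := a) hr,
    ← lintegral_const_mul' _ _ ENNReal.ofReal_ne_top, rieszPotential]
  refine lintegral_congr_ae ?_
  filter_upwards [ae_ne a] with y hy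
  rw [← ofReal_mul_reflectedKernel_inversion hr hx hy]
  ring

theorem conformalPullback_rieszPotential' {l r : ℝ} {a x : E} (hr : 0 < r) (hx : x ≠ a)
    (f : E → ℝ≥0∞) :
    conformalPullback l a r (rieszPotential l f) x = ∫⁻ y, f y * reflectedKernel l a r x y := by
  rw [conformalPullback, rieszPotential, ← lintegral_const_mul' _ _ ENNReal.ofReal_ne_top]
  refine lintegral_congr_ae ?_
  filter_upwards [ae_ne a] with y hy
  rw [← ofReal_mul_rieszKernel_inversion hr hx hy]
  ring

/-- The integrand of four times the Riesz energy after symmetrization under an inversion, in terms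
of the values at two points of the function and of its pullback. -/
def symmetrizedIntegrand (A A' B B' K K' : ℝ≥0∞) : ℝ≥0∞ :=
  (A * B + A' * B') * K + (A * B' + A' * B) * K'

theorem four_mul_rieszEnergy {l r : ℝ} {a : E} (hr : 0 < r) {f : E → ℝ≥0∞} (hf : Measurable f) :
    4 * rieszEnergy l f = ∫⁻ x, ∫⁻ y, symmetrizedIntegrand (f x)
      (conformalPullback (2 * dim - l) a r f x) (f y) (conformalPullback (2 * dim - l) a r f y)
      (rieszKernel l ‖x - y‖) (reflectedKernel l a r x y) := by
  have hu := measurable_rieszPotential (l := l) hf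
  have huσ : Measurable (conformalPullback l a r (rieszPotential l f)) := hu.conformalPullback
  have hfσ : Measurable (conformalPullback (2 * dim - l) a r f) := hf.conformalPullback
  have hK := measurable_rieszKernel_norm_right (E := E) l
  have hK' := measurable_reflectedKernel_right l a r
  have h2 : rieszEnergy l f = ∫⁻ x, conformalPullback (2 * dim - l) a r f x *
      conformalPullback l a r (rieszPotential l f) x :=
    (lintegral_mul_conformalPullback hr (sub_add_cancel _ _) _ _).symm
  have h4 : 4 * rieszEnergy l f = ∫⁻ x, (2 * (f x * rieszPotential l f x) +
      2 * (conformalPullback (2 * dim - l) a r f x *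
        conformalPullback l a r (rieszPotential l f) x)) := by
    rw [lintegral_add_left (by fun_prop), lintegral_const_mul _ (by fun_prop),
      lintegral_const_mul _ (by fun_prop), ← h2, ← rieszEnergy, ← add_mul]
    norm_num
  rw [h4]
  refine lintegral_congr_ae ?_
  filter_upwards [ae_ne a] with x hx
  unfold symmetrizedIntegrand
  have e1 : 2 * (f x * rieszPotential l f x) =
      ∫⁻ y, f x * (f y * rieszKernel l ‖x - y‖ +
        conformalPullback (2 * dim - l) a r f y * reflectedKernel l a r x y) := by
    rw [lintegral_const_mul _ (by fun_prop), lintegral_add_left (by fun_prop),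
      ← rieszPotential_eq_lintegral_reflectedKernel hr, ← rieszPotential]
    ring
  have e2 : 2 * (conformalPullback (2 * dim - l) a r f x *
        conformalPullback l a r (rieszPotential l f) x) =
      ∫⁻ y, conformalPullback (2 * dim - l) a r f x *
        (conformalPullback (2 * dim - l) a r f y * rieszKernel l ‖x - y‖ +
          f y * reflectedKernel l a r x y) := by
    rw [lintegral_const_mul _ (by fun_prop), lintegral_add_left (by fun_prop),
      ← conformalPullback_rieszPotential' hr hx, ← rieszPotential,
      ← conformalPullback_rieszPotential hr hx]
    ring
  rw [e1, e2, ← lintegral_add_left (by fun_prop)]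
  refine lintegral_congr fun y => ?_
  ring

theorem ENNReal.mul_add_mul_le_mul_add_mul_of_le {a b c d : ℝ≥0∞} (hab : a ≤ b) (hcd : c ≤ d) :
    a * d + b * c ≤ a * c + b * d := by
  obtain ⟨b, rfl⟩ := exists_add_of_le hab
  obtain ⟨d, rfl⟩ := exists_add_of_le hcd
  calc a * (c + d) + (a + b) * c ≤ a * (c + d) + (a + b) * c + b * d := le_self_add
    _ = _ := by ring

theorem symmetrizedIntegrand_le {A A' B B' K K' : ℝ≥0∞} (h : K' ≤ K) :
    symmetrizedIntegrand A A' B B' K K' ≤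
      symmetrizedIntegrand (max A A') (min A A') (max B B') (min B B') K K' := by
  unfold symmetrizedIntegrand
  rcases le_total A A' with hA | hA <;> rcases le_total B B' with hB | hB <;>
    simp only [max_eq_left, max_eq_right, min_eq_left, min_eq_right, hA, hB]
  · exact le_of_eq (by ring)
  · have h1 := ENNReal.mul_add_mul_le_mul_add_mul_of_le hA hB
    have h2 := ENNReal.mul_add_mul_le_mul_add_mul_of_le h h1
    calc _ = K' * (A * B' + A' * B) + K * (A * B + A' * B') := by ring
      _ ≤ K' * (A * B + A' * B') + K * (A * B' + A' * B) := h2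
      _ = _ := by ring
  · have h1 := ENNReal.mul_add_mul_le_mul_add_mul_of_le hA hB
    have h2 := ENNReal.mul_add_mul_le_mul_add_mul_of_le h h1
    calc _ = K' * (A * B' + A' * B) + K * (A * B + A' * B') := by ring
      _ ≤ K' * (A * B + A' * B') + K * (A * B' + A' * B) := by convert h2 using 2 <;> ring
      _ = _ := by ring
  · exact le_of_eq (by ring)

theorem symmetrizedIntegrand_swap (A A' B B' K K' : ℝ≥0∞) :
    symmetrizedIntegrand A A' B B' K K' = symmetrizedIntegrand A A' B' B K' K := by
  unfold symmetrizedIntegrand; ring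

theorem symmetrizedIntegrand_swap' (A A' B B' K K' : ℝ≥0∞) :
    symmetrizedIntegrand A A' B B' K K' = symmetrizedIntegrand A' A B' B K K' := by
  unfold symmetrizedIntegrand; ring

/-- Polarization does not decrease the Riesz energy. -/
theorem rieszEnergy_le_rieszEnergy_polarize {l r : ℝ} {a : E} (hl : 0 ≤ l) (hr : 0 < r)
    (hd : 1 + ‖a‖ ^ 2 - r ^ 2 ≠ 0) {f : E → ℝ≥0∞} (hf : Measurable f) :
    rieszEnergy l f ≤ rieszEnergy l (polarize (2 * dim - l) a r f) := by
  have key : 4 * rieszEnergy l f ≤ 4 * rieszEnergy l (polarize (2 * dim - l) a r f) := by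
    rw [four_mul_rieszEnergy (a := a) hr hf, four_mul_rieszEnergy (a := a) hr hf.polarize]
    refine lintegral_mono_ae ?_
    filter_upwards [ae_ne a] with x hx
    refine lintegral_mono_ae ?_
    filter_upwards [ae_ne a] with y hy
    rw [conformalPullback_polarize hr hx hd, conformalPullback_polarize hr hy hd, polarize,
      polarize]
    by_cases hxH : x ∈ polarSide a r <;> by_cases hyH : y ∈ polarSide a r <;>
      simp only [hxH, hyH, if_true, if_false]
    · exact symmetrizedIntegrand_le (reflectedKernel_le_of_mem_iff hl hr hd hy (by tauto))
    · rw [symmetrizedIntegrand_swap, symmetrizedIntegrand_swap (max _ _), min_comm (f y),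
        max_comm (f y)]
      exact symmetrizedIntegrand_le (rieszKernel_le_of_not_mem_iff hl hr hd hy (by tauto))
    · rw [symmetrizedIntegrand_swap, symmetrizedIntegrand_swap (min _ _),
        symmetrizedIntegrand_swap' (min _ _), min_comm (f y), max_comm (f y)]
      exact symmetrizedIntegrand_le (rieszKernel_le_of_not_mem_iff hl hr hd hy (by tauto))
    · rw [symmetrizedIntegrand_swap' (min _ _)]
      exact symmetrizedIntegrand_le (reflectedKernel_le_of_mem_iff hl hr hd hy (by tauto))
  exact (ENNReal.mul_le_mul_iff_right (by norm_num) (by norm_num)).1 key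

end Polarization

section PolarizationDefect

variable {E : Type*} [NormedAddCommGroup E] [InnerProductSpace ℝ E]

/-- The amount by which `f` fails to be polarized. -/
def polarDefect (e : ℝ) (a : E) (r : ℝ) (f : E → ℝ≥0∞) (x : E) : ℝ≥0∞ :=
  open Classical in
  if x ∈ polarSide a r then conformalPullback e a r f x - f x
  else f x - conformalPullback e a r f x

theorem conformalPullback_center {e r : ℝ} {a : E} (he : e ≠ 0) (f : E → ℝ≥0∞) :
    conformalPullback e a r f a = 0 := by
  simp [conformalPullback, he]

theorem conformalPullback_le_bubble {e r : ℝ} {a x : E} (he : 0 < e) (hr : 0 < r)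
    (hx : x ∈ polarSide a r) {f : E → ℝ≥0∞} (hf : ∀ x, f x ≤ bubble e x) :
    conformalPullback e a r f x ≤ bubble e x := by
  by_cases hxa : x = a
  · simp [hxa, conformalPullback_center he.ne']
  · exact (conformalPullback_mono hf x).trans (conformalPullback_bubble_le he.le hr hxa hx)

theorem polarize_le_bubble {e r : ℝ} {a : E} (he : 0 < e) (hr : 0 < r)
    {f : E → ℝ≥0∞} (hf : ∀ x, f x ≤ bubble e x) (x : E) :
    polarize e a r f x ≤ bubble e x := by
  unfold polarize
  split_ifs with hx
  · exact max_le (hf x) (conformalPullback_le_bubble he hr hx hf)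
  · exact (min_le_left _ _).trans (hf x)

theorem polarDefect_le_bubble {e r : ℝ} {a : E} (he : 0 < e) (hr : 0 < r)
    {f : E → ℝ≥0∞} (hf : ∀ x, f x ≤ bubble e x) (x : E) :
    polarDefect e a r f x ≤ bubble e x := by
  unfold polarDefect
  split_ifs with hx
  · exact tsub_le_self.trans (conformalPullback_le_bubble he hr hx hf)
  · exact tsub_le_self.trans (hf x)

theorem ENNReal.max_mul_add_min_mul {x y v w : ℝ≥0∞} (h : v ≤ w) :
    x * w + y * v + (y - x) * (w - v) = max x y * w + min x y * v := by
  rcases le_total x y with hxy | hxy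
  · rw [max_eq_right hxy, min_eq_left hxy]
    have h1 : x + (y - x) = y := add_tsub_cancel_of_le hxy
    have h2 : v + (w - v) = w := add_tsub_cancel_of_le h
    generalize y - x = t at *
    generalize w - v = s at *
    rw [← h1, ← h2]
    ring
  · rw [max_eq_left hxy, min_eq_right hxy, tsub_eq_zero_of_le hxy, zero_mul, add_zero]

variable [MeasurableSpace E] [BorelSpace E] [FiniteDimensional ℝ E]

theorem Measurable.polarDefect {e r : ℝ} {a : E} {f : E → ℝ≥0∞} (hf : Measurable f) :
    Measurable (polarDefect e a r f) := by
  classical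
  exact Measurable.ite (p := fun x => x ∈ polarSide a r) (measurableSet_polarSide a r)
    (hf.conformalPullback.sub hf) (hf.sub hf.conformalPullback)

variable [Nontrivial E]

local notation "dim" => (Module.finrank ℝ E : ℝ)

theorem lintegral_rpow_polarize {e p r : ℝ} {a : E} (hr : 0 < r) (hp : 0 ≤ p)
    (he : e * p = 2 * dim) (hd : 1 + ‖a‖ ^ 2 - r ^ 2 ≠ 0) {f : E → ℝ≥0∞} (hf : Measurable f) :
    ∫⁻ x, polarize e a r f x ^ p = ∫⁻ x, f x ^ p := by
  have key : ∀ g : E → ℝ≥0∞, Measurable g → 2 * ∫⁻ x, g x ^ p =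
      ∫⁻ x, (g x ^ p + conformalPullback e a r g x ^ p) := fun g hg => by
    rw [lintegral_add_left (by fun_prop), lintegral_rpow_conformalPullback hr hp he, two_mul]
  have h2 : 2 * ∫⁻ x, polarize e a r f x ^ p = 2 * ∫⁻ x, f x ^ p := by
    rw [key _ hf.polarize, key _ hf]
    refine lintegral_congr_ae ?_
    filter_upwards [ae_ne a] with x hx
    rw [conformalPullback_polarize hr hx hd, polarize]
    by_cases hxH : x ∈ polarSide a r <;> simp only [hxH, if_true, if_false] <;>
      rcases le_total (f x) (conformalPullback e a r f x) with h | h <;>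
      simp [h, add_comm]
  exact (ENNReal.mul_right_inj (by norm_num) (by norm_num)).1 h2

theorem lintegral_mul_bubble_add_polarDefect {l r : ℝ} {a : E} (hl : 0 < l) (hr : 0 < r)
    (hd : 1 + ‖a‖ ^ 2 - r ^ 2 ≠ 0) {f : E → ℝ≥0∞} (hf : Measurable f) :
    2 * (∫⁻ x, f x * bubble l x) + ∫⁻ x, polarDefect (2 * dim - l) a r f x *
        ((bubble l x - conformalPullback l a r (bubble l) x) +
          (conformalPullback l a r (bubble l) x - bubble l x)) =
      2 * ∫⁻ x, polarize (2 * dim - l) a r f x * bubble l x := by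
  have hb := measurable_bubble (E := E) l
  have hbσ : Measurable (conformalPullback l a r (bubble l)) := hb.conformalPullback
  have hD : Measurable (polarDefect (2 * dim - l) a r f) := hf.polarDefect
  have key : ∀ g : E → ℝ≥0∞, Measurable g → 2 * ∫⁻ x, g x * bubble l x =
      ∫⁻ x, (g x * bubble l x + conformalPullback (2 * dim - l) a r g x *
        conformalPullback l a r (bubble l) x) := fun g hg => by
    rw [lintegral_add_left (by fun_prop),
      lintegral_mul_conformalPullback hr (sub_add_cancel _ _), two_mul]
  rw [key _ hf, key _ hf.polarize, ← lintegral_add_right _ (by fun_prop)]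
  refine lintegral_congr_ae ?_
  filter_upwards [ae_ne a] with x hx
  rw [conformalPullback_polarize hr hx hd, polarize, polarDefect]
  by_cases hxH : x ∈ polarSide a r <;> simp only [hxH, if_true, if_false]
  · have h := conformalPullback_bubble_le hl.le hr hx hxH
    rw [tsub_eq_zero_of_le h, add_zero, ENNReal.max_mul_add_min_mul h]
  · have h := (bubble_lt_conformalPullback hl hr hx hxH).le
    rw [tsub_eq_zero_of_le h, zero_add, add_comm (f x * _), ENNReal.max_mul_add_min_mul h,
      max_comm, min_comm, add_comm]

theorem conformalPullback_rieszPotential_le {l r : ℝ} {a x : E} (hl : 0 ≤ l) (hr : 0 < r)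
    (hd : 1 + ‖a‖ ^ 2 - r ^ 2 ≠ 0) (hx : x ≠ a) (hxH : x ∈ polarSide a r)
    {f : E → ℝ≥0∞} (hf : Measurable f) :
    2 * conformalPullback l a r (rieszPotential l f) x ≤ 2 * rieszPotential l f x +
      ∫⁻ y, polarDefect (2 * dim - l) a r f y *
        (rieszKernel l ‖x - y‖ + reflectedKernel l a r x y) := by
  have hfσ : Measurable (conformalPullback (2 * dim - l) a r f) := hf.conformalPullback
  have hK := measurable_rieszKernel_norm_right (E := E) l
  have hK' := measurable_reflectedKernel_right l a r
  have hD : Measurable (polarDefect (2 * dim - l) a r f) := hf.polarDefect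
  have e1 : 2 * rieszPotential l f x = ∫⁻ y, (f y * rieszKernel l ‖x - y‖ +
        conformalPullback (2 * dim - l) a r f y * reflectedKernel l a r x y) := by
    rw [lintegral_add_left (by fun_prop), ← rieszPotential_eq_lintegral_reflectedKernel hr,
      ← rieszPotential, two_mul]
  have e2 : 2 * conformalPullback l a r (rieszPotential l f) x =
      ∫⁻ y, (conformalPullback (2 * dim - l) a r f y * rieszKernel l ‖x - y‖ +
          f y * reflectedKernel l a r x y) := by
    rw [lintegral_add_left (by fun_prop), ← conformalPullback_rieszPotential' hr hx,
      ← rieszPotential, ← conformalPullback_rieszPotential hr hx, two_mul]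
  rw [e1, e2, ← lintegral_add_right _ (by fun_prop)]
  refine lintegral_mono_ae ?_
  filter_upwards [ae_ne a] with y hy
  have key : ∀ {A B K K' : ℝ≥0∞}, K' ≤ K →
      B * K + A * K' ≤ A * K + B * K' + (B - A) * (K + K') := fun {A B K K'} h => by
    rcases le_total A B with hAB | hAB
    · obtain ⟨t, rfl⟩ := exists_add_of_le hAB
      by_cases hA : A = ∞
      · subst hA
        simp
      · rw [ENNReal.add_sub_cancel_left hA]
        calc (A + t) * K + A * K' ≤ (A + t) * K + A * K' + 2 * (t * K') := le_self_add
          _ = _ := by ring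
    · rw [tsub_eq_zero_of_le hAB, zero_mul, add_zero]
      have := ENNReal.mul_add_mul_le_mul_add_mul_of_le hAB h
      rwa [add_comm (A * K)]
  rw [polarDefect]
  by_cases hyH : y ∈ polarSide a r <;> simp only [hyH, if_true, if_false]
  · exact key (reflectedKernel_le_of_mem_iff hl hr hd hy (by tauto))
  · have := key (A := conformalPullback (2 * dim - l) a r f y) (B := f y)
      (rieszKernel_le_of_not_mem_iff hl hr hd hy (by tauto : ¬ (x ∈ polarSide a r ↔ _)))
    convert this using 1
    · rw [add_comm]
    · rw [add_comm (f y * _), add_comm (rieszKernel _ _)]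

end PolarizationDefect

theorem tendsto_lintegral_mul_of_tendsto_lintegral_mul {X : Type*} [MeasurableSpace X]
    {μ : Measure X} {e : ℕ → X → ℝ≥0∞} {h δ ψ : X → ℝ≥0∞}
    (hh : Measurable h) (hδ : Measurable δ) (hψ : Measurable ψ) (he : ∀ k, Measurable (e k))
    (heh : ∀ k x, e k x ≤ h x) (hfin : ∫⁻ x, h x * ψ x ∂μ ≠ ∞) (hh0 : ∀ x, h x ≠ 0)
    (hδ0 : ∀ᵐ x ∂μ, δ x ≠ 0)
    (hlim : Filter.Tendsto (fun k => ∫⁻ x, e k x * δ x ∂μ) Filter.atTop (nhds 0)) :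
    Filter.Tendsto (fun k => ∫⁻ x, e k x * ψ x ∂μ) Filter.atTop (nhds 0) := by
  have hψtop : ∀ᵐ x ∂μ, ψ x < ∞ := by
    filter_upwards [ae_lt_top (by fun_prop) hfin] with x hx
    by_contra hcon
    rw [not_lt, top_le_iff] at hcon
    simp [hcon, ENNReal.mul_top (hh0 x)] at hx
  have htail : Filter.Tendsto (fun j : ℕ =>
      ∫⁻ x, {x | (j : ℝ≥0∞) * δ x < ψ x}.indicator (fun x => h x * ψ x) x ∂μ)
      Filter.atTop (nhds 0) := by
    have hz : (0 : ℝ≥0∞) = ∫⁻ _, 0 ∂μ := by simp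
    rw [hz]
    refine tendsto_lintegral_of_dominated_convergence (fun x => h x * ψ x) (fun j => ?_)
      (fun j => Filter.Eventually.of_forall fun x => Set.indicator_le_self _ _ _) hfin ?_
    · exact (hh.mul hψ).indicator (measurableSet_lt (by fun_prop) hψ)
    · filter_upwards [hψtop, hδ0] with x hx hx0
      refine tendsto_const_nhds.congr' ?_
      obtain ⟨j, hj⟩ := ENNReal.exists_nat_mul_gt hx0 hx.ne
      filter_upwards [Filter.eventually_ge_atTop j] with i hi
      rw [Set.indicator_of_notMem]
      simp only [Set.mem_ofPred_eq, not_lt]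
      refine hj.le.trans ?_
      gcongr
  rw [ENNReal.tendsto_nhds_zero]
  intro ε hε
  have hε2 : 0 < ε / 2 := ENNReal.half_pos hε.ne'
  obtain ⟨j, hj⟩ := (ENNReal.tendsto_nhds_zero.1 htail (ε / 2) hε2).exists
  have h2 : Filter.Tendsto (fun k => (j : ℝ≥0∞) * ∫⁻ x, e k x * δ x ∂μ) Filter.atTop (nhds 0) := by
    simpa using ENNReal.Tendsto.const_mul hlim (Or.inr (ENNReal.natCast_ne_top j))
  filter_upwards [ENNReal.tendsto_nhds_zero.1 h2 (ε / 2) hε2] with k hk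
  calc ∫⁻ x, e k x * ψ x ∂μ
      ≤ ∫⁻ x, (j * (e k x * δ x) +
        {x | (j : ℝ≥0∞) * δ x < ψ x}.indicator (fun x => h x * ψ x) x) ∂μ := by
        refine lintegral_mono fun x => ?_
        by_cases hx : (j : ℝ≥0∞) * δ x < ψ x
        · rw [Set.indicator_of_mem (by exact hx)]
          exact le_add_left (by gcongr; exact heh k x)
        · refine le_add_right ?_
          calc e k x * ψ x ≤ e k x * (j * δ x) := by gcongr; exact not_lt.1 hx
            _ = _ := by ring
    _ = j * ∫⁻ x, e k x * δ x ∂μ +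
        ∫⁻ x, {x | (j : ℝ≥0∞) * δ x < ψ x}.indicator (fun x => h x * ψ x) x ∂μ := by
        rw [lintegral_add_left (by fun_prop), lintegral_const_mul _ (by fun_prop)]
    _ ≤ ε / 2 + ε / 2 := by gcongr
    _ = ε := ENNReal.add_halves ε

section Swap

variable {E : Type*} [NormedAddCommGroup E] [InnerProductSpace ℝ E]

/-- The radius of the sphere centred at `-s • x` whose inversion exchanges `0` and `x`. -/
def swapRadius (s : ℝ) (x : E) : ℝ := √(s * (1 + s)) * ‖x‖

theorem swapRadius_pos {s : ℝ} {x : E} (hs : 0 < s) (hx : x ≠ 0) : 0 < swapRadius s x := by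
  have := norm_pos_iff.2 hx
  unfold swapRadius; positivity

theorem swapRadius_sq {s : ℝ} (hs : 0 < s) (x : E) :
    swapRadius s x ^ 2 = s * (1 + s) * ‖x‖ ^ 2 := by
  rw [swapRadius, mul_pow, sq_sqrt (by positivity)]

theorem norm_zero_sub_swapCenter {s : ℝ} (hs : 0 < s) (x : E) :
    ‖(0 : E) - (-s • x)‖ = s * ‖x‖ := by
  rw [neg_smul, sub_neg_eq_add, zero_add, norm_smul, Real.norm_of_nonneg hs.le]

theorem norm_sub_swapCenter {s : ℝ} (hs : 0 < s) (x : E) :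
    ‖x - (-s • x)‖ = (1 + s) * ‖x‖ := by
  have : x - (-s • x) = (1 + s) • x := by module
  rw [this, norm_smul, Real.norm_of_nonneg (by positivity)]

theorem inversion_swap_zero {s : ℝ} {x : E} (hs : 0 < s) (hx : x ≠ 0) :
    inversion (-s • x) (swapRadius s x) 0 = x := by
  have hx' : ‖x‖ ≠ 0 := norm_ne_zero_iff.2 hx
  rw [EuclideanGeometry.inversion_def]
  simp only [dist_eq_norm, vsub_eq_sub, vadd_eq_add]
  rw [norm_zero_sub_swapCenter hs, div_pow, swapRadius_sq hs]
  have : s * (1 + s) * ‖x‖ ^ 2 / (s * ‖x‖) ^ 2 = (1 + s) / s := by field_simp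
  rw [this, neg_smul, zero_sub, neg_neg, smul_smul, div_mul_cancel₀ _ hs.ne']
  module

theorem inversion_swap_self {s : ℝ} {x : E} (hs : 0 < s) (hx : x ≠ 0) :
    inversion (-s • x) (swapRadius s x) x = 0 := by
  have := EuclideanGeometry.inversion_inversion (-s • x) (swapRadius_pos hs hx).ne' (0 : E)
  rwa [inversion_swap_zero hs hx] at this

theorem zero_ne_swapCenter {s : ℝ} {x : E} (hs : 0 < s) (hx : x ≠ 0) : (0 : E) ≠ -s • x := by
  rw [ne_comm, neg_smul, neg_ne_zero]
  exact smul_ne_zero hs.ne' hx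

theorem ne_swapCenter {s : ℝ} {x : E} (hs : 0 < s) (hx : x ≠ 0) : x ≠ -s • x := by
  have := norm_sub_swapCenter hs x
  intro h
  rw [sub_eq_zero.2 h, norm_zero] at this
  have := norm_pos_iff.2 hx
  nlinarith

theorem conformalPullback_swap_zero {l s : ℝ} {x : E} (hs : 0 < s) (hx : x ≠ 0)
    (f : E → ℝ≥0∞) :
    conformalPullback l (-s • x) (swapRadius s x) f 0 =
      ENNReal.ofReal (((1 + s) / s) ^ (l / 2)) * f x := by
  have hx' := norm_pos_iff.2 hx
  rw [conformalPullback, inversion_swap_zero hs hx, norm_zero_sub_swapCenter hs]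
  have h : swapRadius s x / (s * ‖x‖) = ((1 + s) / s) ^ (1 / 2 : ℝ) := by
    rw [← sqrt_eq_rpow, eq_comm, sqrt_eq_iff_mul_self_eq (by positivity)
      (div_nonneg (swapRadius_pos hs hx).le (by positivity)), ← sq, div_pow, swapRadius_sq hs]
    field_simp
  rw [h, ← rpow_mul (by positivity)]
  congr 3; ring

theorem conformalPullback_swap_self {l s : ℝ} {x : E} (hs : 0 < s) (hx : x ≠ 0)
    (f : E → ℝ≥0∞) :
    conformalPullback l (-s • x) (swapRadius s x) f x =
      ENNReal.ofReal ((s / (1 + s)) ^ (l / 2)) * f 0 := by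
  have hx' := norm_pos_iff.2 hx
  rw [conformalPullback, inversion_swap_self hs hx, norm_sub_swapCenter hs]
  have h : swapRadius s x / ((1 + s) * ‖x‖) = (s / (1 + s)) ^ (1 / 2 : ℝ) := by
    rw [← sqrt_eq_rpow, eq_comm, sqrt_eq_iff_mul_self_eq (by positivity)
      (div_nonneg (swapRadius_pos hs hx).le (by positivity)), ← sq, div_pow, swapRadius_sq hs]
    field_simp
  rw [h, ← rpow_mul (by positivity)]
  congr 3; ring

theorem one_add_norm_swapCenter_sq {s : ℝ} (hs : 0 < s) (x : E) :
    1 + ‖-s • x‖ ^ 2 - swapRadius s x ^ 2 = 1 - s * ‖x‖ ^ 2 := by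
  rw [swapRadius_sq hs, norm_smul, norm_neg, Real.norm_of_nonneg hs.le]
  ring

theorem mem_polarSide_swap_of_lt {s : ℝ} {x : E} (hs : 0 < s) (h : s * ‖x‖ ^ 2 < 1) :
    x ∈ polarSide (-s • x) (swapRadius s x) := by
  simp only [polarSide, Set.mem_ofPred_eq]
  rw [one_add_norm_swapCenter_sq hs, norm_sub_swapCenter hs, swapRadius, ← sub_mul]
  have h1 : √(s * (1 + s)) ≤ 1 + s := by
    rw [sqrt_le_left (by positivity)]
    nlinarith
  have := norm_nonneg x
  have h2 : 0 ≤ 1 + s - √(s * (1 + s)) := by linarith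
  have h3 : 0 ≤ 1 - s * ‖x‖ ^ 2 := by linarith
  positivity

theorem zero_mem_polarSide_swap_of_lt {s : ℝ} {x : E} (hs : 0 < s) (h : 1 < s * ‖x‖ ^ 2) :
    (0 : E) ∈ polarSide (-s • x) (swapRadius s x) := by
  simp only [polarSide, Set.mem_ofPred_eq]
  rw [one_add_norm_swapCenter_sq hs, norm_zero_sub_swapCenter hs, swapRadius, ← sub_mul]
  have h1 : s ≤ √(s * (1 + s)) := by
    apply le_sqrt_of_sq_le
    nlinarith
  refine mul_nonneg_of_nonpos_of_nonpos (by linarith) ?_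
  exact mul_nonpos_of_nonpos_of_nonneg (by linarith) (norm_nonneg _)

variable [MeasurableSpace E] [BorelSpace E] [FiniteDimensional ℝ E] [Nontrivial E]

local notation "dim" => (Module.finrank ℝ E : ℝ)

theorem rieszPotential_bubble (l : ℝ) (x : E) :
    rieszPotential l (bubble (2 * dim - l)) x =
      rieszPotential l (bubble (2 * dim - l)) (0 : E) * bubble l x := by
  by_cases hx : x = 0
  · rw [hx, bubble_zero, mul_one]
  have hx' := norm_pos_iff.2 hx
  have hs : 0 < (‖x‖ ^ 2)⁻¹ := by positivity
  have hr := swapRadius_pos hs hx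
  have h1 := conformalPullback_rieszPotential (l := l) hr (zero_ne_swapCenter hs hx)
    (bubble (2 * dim - l))
  rw [conformalPullback_swap_zero hs hx] at h1
  have h2 : rieszPotential l (conformalPullback (2 * dim - l) (-(‖x‖ ^ 2)⁻¹ • x)
      (swapRadius (‖x‖ ^ 2)⁻¹ x) (bubble (2 * dim - l))) 0 =
      rieszPotential l (bubble (2 * dim - l)) (0 : E) := by
    refine lintegral_congr_ae ?_
    filter_upwards [ae_ne (-(‖x‖ ^ 2)⁻¹ • x)] with y hy
    rw [conformalPullback_bubble_of_eq hr hy]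
    have := one_add_norm_swapCenter_sq hs x
    rw [inv_mul_cancel₀ (by positivity)] at this
    linarith
  rw [h2] at h1
  rw [← h1, bubble, mul_right_comm, ← ENNReal.ofReal_mul (by positivity)]
  have : (1 + (‖x‖ ^ 2)⁻¹) / (‖x‖ ^ 2)⁻¹ = 1 + ‖x‖ ^ 2 := by field_simp; ring
  rw [this, ← rpow_add (by positivity)]
  simp

end Swap

section AsymptoticSymmetry

variable {E : Type*} [NormedAddCommGroup E] [InnerProductSpace ℝ E]

theorem bubble_le_one {e : ℝ} (he : 0 ≤ e) (x : E) : bubble e x ≤ 1 := by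
  unfold bubble
  rw [ENNReal.ofReal_le_one]
  exact rpow_le_one_of_one_le_of_nonpos (by nlinarith [sq_nonneg ‖x‖]) (by linarith)

variable [MeasurableSpace E] [BorelSpace E] [FiniteDimensional ℝ E] [Nontrivial E]

local notation "dim" => (Module.finrank ℝ E : ℝ)

theorem ae_bubble_sub_conformalPullback_ne_zero {l r : ℝ} {a : E} (hl : 0 < l) (hr : 0 < r)
    (hd : 1 + ‖a‖ ^ 2 - r ^ 2 ≠ 0) :
    ∀ᵐ x : E, (bubble l x - conformalPullback l a r (bubble l) x) +
      (conformalPullback l a r (bubble l) x - bubble l x) ≠ 0 := by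
  have hs : ∀ᵐ x : E, ‖x - a‖ ≠ r := by
    have h0 := Measure.addHaar_sphere (volume : Measure E) a r
    rw [ae_iff]
    convert h0 using 2
    ext x
    simp
  filter_upwards [ae_ne a, hs] with x hx hxr
  by_cases hxH : x ∈ polarSide a r
  · have := tsub_pos_of_lt (conformalPullback_bubble_lt hl hr hx hd hxH hxr)
    exact (this.trans_le le_self_add).ne'
  · have := tsub_pos_of_lt (bubble_lt_conformalPullback hl hr hx hxH)
    exact (this.trans_le le_add_self).ne'

theorem tendsto_lintegral_polarDefect_mul_kernel {l r : ℝ} {a x : E} (hl : 0 < l)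
    (hr : 0 < r) (hd : 1 + ‖a‖ ^ 2 - r ^ 2 ≠ 0) (hx : x ≠ a) (hld : l < 2 * dim)
    (hκ : rieszPotential l (bubble (2 * dim - l)) (0 : E) ≠ ∞)
    {f : ℕ → E → ℝ≥0∞} (hf : ∀ k, Measurable (f k)) (hfh : ∀ k x, f k x ≤ bubble (2 * dim - l) x)
    (hlim : Filter.Tendsto (fun k => ∫⁻ x, polarDefect (2 * dim - l) a r (f k) x *
        ((bubble l x - conformalPullback l a r (bubble l) x) +
          (conformalPullback l a r (bubble l) x - bubble l x))) Filter.atTop (nhds 0)) :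
    Filter.Tendsto (fun k => ∫⁻ y, polarDefect (2 * dim - l) a r (f k) y *
        (rieszKernel l ‖x - y‖ + reflectedKernel l a r x y)) Filter.atTop (nhds 0) := by
  have hb := measurable_bubble (E := E) l
  have hh := measurable_bubble (E := E) (2 * dim - l)
  have hbσ : Measurable (conformalPullback l a r (bubble l)) := hb.conformalPullback
  have hK := measurable_rieszKernel_norm_right (E := E) l
  have hK' := measurable_reflectedKernel_right l a r
  have hfin : ∀ y : E, rieszPotential l (bubble (2 * dim - l)) y ≠ ∞ := fun y => by
    rw [rieszPotential_bubble]
    exact ENNReal.mul_ne_top hκ (bubble_ne_top _ _)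
  refine tendsto_lintegral_mul_of_tendsto_lintegral_mul hh (by fun_prop) (by fun_prop)
    (fun k => (hf k).polarDefect) (fun k => polarDefect_le_bubble (by linarith) hr (hfh k)) ?_
    (bubble_ne_zero _) (ae_bubble_sub_conformalPullback_ne_zero hl hr hd) hlim
  simp_rw [mul_add]
  rw [lintegral_add_left (by fun_prop), ← conformalPullback_rieszPotential' hr hx,
    ← rieszPotential]
  exact ENNReal.add_ne_top.2 ⟨hfin x, ENNReal.mul_ne_top ENNReal.ofReal_ne_top (hfin _)⟩

/-- If the polarization defects tend to zero for all inversions, then the potentials approach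
multiples of a bubble. -/
theorem tendsto_rieszPotential_sub_bubble {l : ℝ} (hl : 0 < l) (hld : l < 2 * dim)
    (hκ : rieszPotential l (bubble (2 * dim - l)) (0 : E) ≠ ∞)
    {f : ℕ → E → ℝ≥0∞} (hf : ∀ k, Measurable (f k)) (hfh : ∀ k x, f k x ≤ bubble (2 * dim - l) x)
    (hlim : ∀ (a : E) (r : ℝ), 0 < r → 1 + ‖a‖ ^ 2 - r ^ 2 ≠ 0 →
      Filter.Tendsto (fun k => ∫⁻ x, polarDefect (2 * dim - l) a r (f k) x *
        ((bubble l x - conformalPullback l a r (bubble l) x) +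
          (conformalPullback l a r (bubble l) x - bubble l x))) Filter.atTop (nhds 0))
    {x : E} (hx : x ≠ 0) :
    Filter.Tendsto (fun k =>
      (rieszPotential l (f k) x - bubble l x * rieszPotential l (f k) 0) +
      (bubble l x * rieszPotential l (f k) 0 - rieszPotential l (f k) x))
      Filter.atTop (nhds 0) := by
  have hx' := norm_pos_iff.2 hx
  set κ := rieszPotential l (bubble (2 * dim - l)) (0 : E) with hκdef
  have hA : ∀ k, rieszPotential l (f k) 0 ≤ κ := fun k => rieszPotential_mono (hfh k) 0
  have hw1 : bubble l x ≤ 1 := bubble_le_one hl.le x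
  have hB : ∀ k, rieszPotential l (f k) x ≤ κ := fun k => by
    refine (rieszPotential_mono (hfh k) x).trans ?_
    rw [rieszPotential_bubble]
    exact mul_le_of_le_one_right' hw1
  have hs0 : 0 < (‖x‖ ^ 2)⁻¹ := by positivity
  have htwo : ∀ {A B C : ℝ≥0∞}, 2 * A ≤ 2 * B + C → A ≤ B + C := fun {A B C} h => by
    refine (ENNReal.mul_le_mul_iff_right (a := 2) (by norm_num) (by norm_num)).1 (h.trans ?_)
    rw [mul_add]
    gcongr
    exact le_mul_of_one_le_left' (by norm_num)
  have lim1 : Filter.Tendsto (fun k => rieszPotential l (f k) x -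
      bubble l x * rieszPotential l (f k) 0) Filter.atTop (nhds 0) := by
    rw [ENNReal.tendsto_nhds_zero]
    intro ε hε
    have hε2 : 0 < ε / 2 := ENNReal.half_pos hε.ne'
    have hcont : Filter.Tendsto (fun s : ℝ => (1 - bubble l x *
        ENNReal.ofReal (((1 + s) / s) ^ (l / 2))) * κ)
        (nhdsWithin (‖x‖ ^ 2)⁻¹ (Set.Ioi (‖x‖ ^ 2)⁻¹)) (nhds 0) := by
      have h1 : ContinuousAt (fun s : ℝ => ((1 + s) / s) ^ (l / 2)) (‖x‖ ^ 2)⁻¹ := by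
        refine ContinuousAt.rpow_const ?_ (Or.inr (by positivity))
        exact (continuousAt_const.add continuousAt_id).div continuousAt_id hs0.ne'
      have h2 := (ENNReal.continuous_ofReal.tendsto _).comp h1.tendsto
      have h3 := ENNReal.Tendsto.mul_const (ENNReal.Tendsto.sub
        (tendsto_const_nhds (x := (1 : ℝ≥0∞))) (ENNReal.Tendsto.const_mul (a := bubble l x) h2
        (Or.inr (bubble_ne_top _ _))) (Or.inl ENNReal.one_ne_top)) (Or.inr hκ)
      refine (h3.mono_left nhdsWithin_le_nhds).trans_eq ?_
      have e1 : (1 + (‖x‖ ^ 2)⁻¹) / (‖x‖ ^ 2)⁻¹ = 1 + ‖x‖ ^ 2 := by field_simp; ring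
      rw [e1, bubble, ← ENNReal.ofReal_mul (by positivity), ← rpow_add (by positivity)]
      simp
    obtain ⟨s, hs, hss⟩ := ((ENNReal.tendsto_nhds_zero.1 hcont (ε / 2) hε2).and
      self_mem_nhdsWithin).exists
    have hspos : 0 < s := hs0.trans hss
    replace hss : 1 < s * ‖x‖ ^ 2 := (inv_lt_iff_one_lt_mul₀ (by positivity)).1 hss
    have hr := swapRadius_pos hspos hx
    have hd : 1 + ‖-s • x‖ ^ 2 - swapRadius s x ^ 2 ≠ 0 := by
      rw [one_add_norm_swapCenter_sq hspos]
      exact (sub_neg.2 hss).ne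
    have hI := tendsto_lintegral_polarDefect_mul_kernel hl hr hd (zero_ne_swapCenter hspos hx)
      hld hκ hf hfh (hlim _ _ hr hd)
    filter_upwards [ENNReal.tendsto_nhds_zero.1 hI (ε / 2) hε2] with k hk
    have key := conformalPullback_rieszPotential_le hl.le hr hd (zero_ne_swapCenter hspos hx)
      (zero_mem_polarSide_swap_of_lt hspos hss) (hf k)
    rw [conformalPullback_swap_zero hspos hx] at key
    have key' := (htwo key).trans (add_le_add_right hk _)
    set A := rieszPotential l (f k) 0
    set B := rieszPotential l (f k) x
    set c := ENNReal.ofReal (((1 + s) / s) ^ (l / 2))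
    set w := bubble l x
    rw [tsub_le_iff_right]
    calc B = 1 * B := (one_mul _).symm
      _ ≤ (1 - w * c + w * c) * B := by gcongr; exact le_tsub_add
      _ = (1 - w * c) * B + w * (c * B) := by ring
      _ ≤ (1 - w * c) * κ + w * (A + ε / 2) := by gcongr; exact hB k
      _ ≤ ε / 2 + (w * A + 1 * (ε / 2)) := by rw [mul_add]; gcongr
      _ = (ε / 2 + ε / 2) + w * A := by ring
      _ = ε + w * A := by rw [ENNReal.add_halves]
  have lim2 : Filter.Tendsto (fun k => bubble l x * rieszPotential l (f k) 0 -
      rieszPotential l (f k) x) Filter.atTop (nhds 0) := by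
    rw [ENNReal.tendsto_nhds_zero]
    intro ε hε
    have hε2 : 0 < ε / 2 := ENNReal.half_pos hε.ne'
    have hcont : Filter.Tendsto (fun s : ℝ => (bubble l x -
        ENNReal.ofReal ((s / (1 + s)) ^ (l / 2))) * κ)
        (nhdsWithin (‖x‖ ^ 2)⁻¹ (Set.Iio (‖x‖ ^ 2)⁻¹)) (nhds 0) := by
      have h1 : ContinuousAt (fun s : ℝ => (s / (1 + s)) ^ (l / 2)) (‖x‖ ^ 2)⁻¹ := by
        refine ContinuousAt.rpow_const ?_ (Or.inr (by positivity))
        exact continuousAt_id.div (continuousAt_const.add continuousAt_id)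
          (by positivity)
      have h2 := (ENNReal.continuous_ofReal.tendsto _).comp h1.tendsto
      have h3 := ENNReal.Tendsto.mul_const (ENNReal.Tendsto.sub
        (tendsto_const_nhds (x := bubble l x)) h2 (Or.inl (bubble_ne_top _ _))) (Or.inr hκ)
      refine (h3.mono_left nhdsWithin_le_nhds).trans_eq ?_
      have e1 : (‖x‖ ^ 2)⁻¹ / (1 + (‖x‖ ^ 2)⁻¹) = (1 + ‖x‖ ^ 2)⁻¹ := by field_simp; ring
      rw [e1, bubble, inv_rpow (by positivity), ← rpow_neg (by positivity)]
      simp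
    obtain ⟨s, ⟨hs, hss⟩, hspos⟩ := (((ENNReal.tendsto_nhds_zero.1 hcont (ε / 2) hε2).and
      self_mem_nhdsWithin).and (nhdsWithin_le_nhds (lt_mem_nhds hs0))).exists
    replace hss : s * ‖x‖ ^ 2 < 1 :=
      (lt_inv_mul_iff₀' (b := 1) (by positivity)).1 (by simpa using hss)
    have hr := swapRadius_pos hspos hx
    have hd : 1 + ‖-s • x‖ ^ 2 - swapRadius s x ^ 2 ≠ 0 := by
      rw [one_add_norm_swapCenter_sq hspos]
      exact (sub_pos.2 hss).ne'
    have hI := tendsto_lintegral_polarDefect_mul_kernel hl hr hd (ne_swapCenter hspos hx)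
      hld hκ hf hfh (hlim _ _ hr hd)
    filter_upwards [ENNReal.tendsto_nhds_zero.1 hI (ε / 2) hε2] with k hk
    have key := conformalPullback_rieszPotential_le hl.le hr hd (ne_swapCenter hspos hx)
      (mem_polarSide_swap_of_lt hspos hss) (hf k)
    rw [conformalPullback_swap_self hspos hx] at key
    have key' := (htwo key).trans (add_le_add_right hk _)
    set A := rieszPotential l (f k) 0
    set B := rieszPotential l (f k) x
    set c := ENNReal.ofReal ((s / (1 + s)) ^ (l / 2))
    set w := bubble l x
    rw [tsub_le_iff_right]
    calc w * A ≤ (w - c + c) * A := by gcongr; exact le_tsub_add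
      _ = (w - c) * A + c * A := by ring
      _ ≤ (w - c) * κ + (B + ε / 2) := by gcongr; exact hA k
      _ ≤ ε / 2 + (B + ε / 2) := by gcongr
      _ = (ε / 2 + ε / 2) + B := by ring
      _ = ε + B := by rw [ENNReal.add_halves]
  simpa using lim1.add lim2

end AsymptoticSymmetry

end Polarizations

section SharpHLS

variable {E : Type*} [NormedAddCommGroup E] [InnerProductSpace ℝ E]
  [MeasurableSpace E] [BorelSpace E] [FiniteDimensional ℝ E]

theorem lintegral_mul_rieszPotential_comm {l : ℝ} {f g : E → ℝ≥0∞} (hf : Measurable f)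
    (hg : Measurable g) :
    ∫⁻ x, f x * rieszPotential l g x = ∫⁻ x, g x * rieszPotential l f x := by
  have hK := measurable_rieszKernel_norm_right (E := E) l
  have hK2 := measurable_rieszKernel_norm (E := E) l
  have h : ∀ f g : E → ℝ≥0∞, Measurable f → Measurable g → ∫⁻ x, f x * rieszPotential l g x =
      ∫⁻ x, ∫⁻ y, f x * (g y * rieszKernel l ‖x - y‖) := fun f g hf hg => by
    refine lintegral_congr fun x => ?_
    rw [lintegral_const_mul _ (by fun_prop), rieszPotential]
  rw [h f g hf hg, h g f hg hf, lintegral_lintegral_swap (by fun_prop)]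
  refine lintegral_congr fun x => lintegral_congr fun y => ?_
  rw [norm_sub_rev]
  ring

variable [Nontrivial E]

local notation "dim" => (Module.finrank ℝ E : ℝ)

theorem lintegral_mul_bubble_le {l : ℝ} (hl : 0 < l) (hld : l < 2 * dim)
    {f : E → ℝ≥0∞} (hf : Measurable f) :
    ∫⁻ x, f x * bubble l x ≤
      (∫⁻ x, f x ^ (2 * dim / (2 * dim - l))) ^ ((2 * dim - l) / (2 * dim)) *
        (∫⁻ x : E, bubble (2 * dim) x) ^ (l / (2 * dim)) := by
  have hd : 0 < 2 * dim := hl.trans hld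
  have hpq : (2 * dim / (2 * dim - l)).HolderConjugate (2 * dim / l) := by
    rw [Real.holderConjugate_iff]
    refine ⟨(one_lt_div (by linarith)).2 (by linarith), ?_⟩
    rw [inv_div, inv_div, ← add_div, sub_add_cancel, div_self hd.ne']
  have h := ENNReal.lintegral_mul_le_Lp_mul_Lq volume hpq hf.aemeasurable
    (measurable_bubble (E := E) l).aemeasurable
  simp only [Pi.mul_apply, one_div, inv_div] at h
  refine h.trans_eq ?_
  congr 2
  refine lintegral_congr fun x => ?_
  rw [bubble_rpow _ _ (by positivity)]
  congr 1
  field_simp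

theorem rieszEnergy_le_of_le_bubble {l : ℝ} (hl : 0 < l) (hld : l < 2 * dim)
    (hκ : rieszPotential l (bubble (2 * dim - l)) (0 : E) ≠ ∞)
    (hB : ∫⁻ x : E, bubble (2 * dim) x ≠ ∞)
    {f : E → ℝ≥0∞} (hf : Measurable f) (hfh : ∀ x, f x ≤ bubble (2 * dim - l) x) :
    rieszEnergy l f * ∫⁻ x : E, bubble (2 * dim) x ≤
      rieszPotential l (bubble (2 * dim - l)) (0 : E) *
        ((∫⁻ x, f x ^ (2 * dim / (2 * dim - l))) ^ ((2 * dim - l) / (2 * dim)) *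
        (∫⁻ x : E, bubble (2 * dim) x) ^ (l / (2 * dim))) ^ 2 := by
  set h : E → ℝ≥0∞ := bubble (2 * dim - l) with hh
  set w : E → ℝ≥0∞ := bubble l with hw
  set κ := rieszPotential l h (0 : E) with hκdef
  set B := ∫⁻ x : E, bubble (2 * dim) x with hBdef
  have hd : 0 < 2 * dim := hl.trans hld
  have hhm : Measurable h := measurable_bubble _
  have hwm : Measurable w := measurable_bubble _
  have hhw : ∀ x, h x * w x = bubble (2 * dim) x := fun x => by
    rw [hh, hw, bubble_mul, sub_add_cancel]
  have hLh : ∫⁻ x, h x * w x = B := lintegral_congr hhw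
  have hp : (2 * dim - l) * (2 * dim / (2 * dim - l)) = 2 * dim :=
    mul_div_cancel₀ _ (sub_pos.2 hld).ne'
  have hp0 : 0 ≤ 2 * dim / (2 * dim - l) := div_nonneg hd.le (sub_pos.2 hld).le
  set S : Set (E → ℝ≥0∞) := {g | Measurable g ∧ (∀ x, g x ≤ h x) ∧
    (∫⁻ x, g x ^ (2 * dim / (2 * dim - l)) = ∫⁻ x, f x ^ (2 * dim / (2 * dim - l))) ∧
    rieszEnergy l f ≤ rieszEnergy l g} with hS
  set L : (E → ℝ≥0∞) → ℝ≥0∞ := fun g => ∫⁻ x, g x * w x with hL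
  have hfS : f ∈ S := ⟨hf, hfh, rfl, le_rfl⟩
  have hLB : ∀ g ∈ S, L g ≤ B := fun g hg => by
    rw [← hLh]
    exact lintegral_mono fun x => mul_le_mul_left (hg.2.1 x) _
  obtain ⟨M, hMmono, hMlim, hMmem⟩ := exists_seq_tendsto_sSup (S := L '' S)
    ⟨_, Set.mem_image_of_mem L hfS⟩ (OrderTop.bddAbove _)
  choose g hgS hgM using hMmem
  have hsup : sSup (L '' S) ≠ ∞ := by
    refine ne_top_of_le_ne_top hB (sSup_le ?_)
    rintro _ ⟨g, hg, rfl⟩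
    exact hLB g hg
  have hgm : ∀ k, Measurable (g k) := fun k => (hgS k).1
  have hgh : ∀ k x, g k x ≤ h x := fun k => (hgS k).2.1
  have hlim : ∀ (a : E) (r : ℝ), 0 < r → 1 + ‖a‖ ^ 2 - r ^ 2 ≠ 0 →
      Filter.Tendsto (fun k => ∫⁻ x, polarDefect (2 * dim - l) a r (g k) x *
        ((bubble l x - conformalPullback l a r (bubble l) x) +
          (conformalPullback l a r (bubble l) x - bubble l x))) Filter.atTop (nhds 0) := by
    intro a r hr hD
    have hto : Filter.Tendsto (fun k => 2 * sSup (L '' S) - 2 * M k) Filter.atTop (nhds 0) := by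
      have h2 := ENNReal.Tendsto.const_mul (a := 2) hMlim (Or.inr (by norm_num))
      have h3 := ENNReal.Tendsto.sub (tendsto_const_nhds (x := 2 * sSup (L '' S))
        (f := Filter.atTop (α := ℕ))) h2 (Or.inl (ENNReal.mul_ne_top (by norm_num) hsup))
      simpa using h3
    refine tendsto_of_tendsto_of_tendsto_of_le_of_le tendsto_const_nhds hto (fun _ => zero_le)
      fun k => ?_
    have h1 := lintegral_mul_bubble_add_polarDefect hl hr hD (hgm k)
    have hF : polarize (2 * dim - l) a r (g k) ∈ S :=
      ⟨(hgm k).polarize, polarize_le_bubble (by linarith) hr (hgh k),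
        (lintegral_rpow_polarize hr hp0 hp hD (hgm k)).trans (hgS k).2.2.1,
        (hgS k).2.2.2.trans (rieszEnergy_le_rieszEnergy_polarize hl.le hr hD (hgm k))⟩
    have h2 : L (polarize (2 * dim - l) a r (g k)) ≤ sSup (L '' S) :=
      le_sSup (Set.mem_image_of_mem L hF)
    have hMfin : 2 * M k ≠ ∞ := by
      rw [← hgM]
      exact ENNReal.mul_ne_top (by norm_num) (ne_top_of_le_ne_top hB (hLB _ (hgS k)))
    refine ENNReal.le_sub_of_add_le_left hMfin ?_
    rw [← hgM]
    refine h1.le.trans ?_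
    gcongr
  have hpt := fun x (hx : x ≠ 0) => tendsto_rieszPotential_sub_bubble hl hld hκ hgm hgh hlim hx
  set η : ℕ → E → ℝ≥0∞ := fun k x => (rieszPotential l (g k) x - w x * rieszPotential l (g k) 0) +
      (w x * rieszPotential l (g k) 0 - rieszPotential l (g k) x) with hη
  have hηm : ∀ k, Measurable (η k) := fun k => by
    have := measurable_rieszPotential (l := l) (hgm k)
    fun_prop
  have hu0 : ∀ k, rieszPotential l (g k) 0 ≤ κ := fun k => rieszPotential_mono (hgh k) 0
  have herr : Filter.Tendsto (fun k => ∫⁻ x, h x * η k x) Filter.atTop (nhds 0) := by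
    have hz : (0 : ℝ≥0∞) = ∫⁻ _ : E, 0 := by simp
    rw [hz]
    refine tendsto_lintegral_of_dominated_convergence (fun x => h x * (2 * κ * w x))
      (fun k => hhm.mul (hηm k)) (fun k => Filter.Eventually.of_forall fun x => ?_) ?_ ?_
    · have hux : rieszPotential l (g k) x ≤ κ * w x :=
        (rieszPotential_mono (hgh k) x).trans_eq (rieszPotential_bubble l x)
      refine mul_le_mul_right ?_ _
      calc η k x ≤ rieszPotential l (g k) x + w x * rieszPotential l (g k) 0 :=
            add_le_add tsub_le_self tsub_le_self
        _ ≤ κ * w x + w x * κ := by gcongr; exact hu0 k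
        _ = _ := by ring
    · have : ∀ x, h x * (2 * κ * w x) = 2 * κ * (h x * w x) := fun x => by ring
      simp_rw [this]
      rw [lintegral_const_mul _ (by fun_prop), hLh]
      exact ENNReal.mul_ne_top (ENNReal.mul_ne_top (by norm_num) hκ) hB
    · filter_upwards [ae_ne (0 : E)] with x hx
      simpa using ENNReal.Tendsto.const_mul (hpt x hx) (Or.inr (bubble_ne_top _ _))
  set R := ((∫⁻ x, f x ^ (2 * dim / (2 * dim - l))) ^ ((2 * dim - l) / (2 * dim)) *
        B ^ (l / (2 * dim))) with hR
  have hbound : ∀ k, rieszEnergy l f * B ≤ κ * R ^ 2 + 2 * B * ∫⁻ x, h x * η k x := by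
    intro k
    set u := rieszPotential l (g k) with hu
    have hum : Measurable u := measurable_rieszPotential (hgm k)
    set err := ∫⁻ x, h x * η k x with herrdef
    have hLR : L (g k) ≤ R := by
      have := lintegral_mul_bubble_le hl hld (hgm k)
      rwa [(hgS k).2.2.1] at this
    have h1 : rieszEnergy l (g k) ≤ u 0 * L (g k) + err := by
      calc rieszEnergy l (g k) ≤ ∫⁻ x, (u 0 * (g k x * w x) + h x * η k x) := by
            refine lintegral_mono fun x => ?_
            calc g k x * u x ≤ g k x * (w x * u 0 + η k x) := by
                  gcongr
                  rw [add_comm]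
                  exact (le_tsub_add).trans (add_le_add_left le_self_add _)
              _ = u 0 * (g k x * w x) + g k x * η k x := by ring
              _ ≤ _ := by gcongr; exact hgh k x
        _ = u 0 * L (g k) + err := by
            have hg := hgm k
            rw [lintegral_add_left (by fun_prop), lintegral_const_mul _ (by fun_prop)]
    have h2 : u 0 * B ≤ κ * L (g k) + err := by
      calc u 0 * B = ∫⁻ x, h x * (w x * u 0) := by
            rw [← hLh, ← lintegral_const_mul _ (by fun_prop)]
            exact lintegral_congr fun x => by ring
        _ ≤ ∫⁻ x, (h x * u x + h x * η k x) := by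
            refine lintegral_mono fun x => ?_
            rw [← mul_add]
            gcongr
            rw [add_comm]
            exact (le_tsub_add).trans (add_le_add_left le_add_self _)
        _ = (∫⁻ x, g k x * rieszPotential l h x) + err := by
            rw [lintegral_add_left (by fun_prop), lintegral_mul_rieszPotential_comm hhm (hgm k)]
        _ = κ * L (g k) + err := by
            have hg := hgm k
            congr 1
            rw [hL, ← lintegral_const_mul _ (by fun_prop)]
            refine lintegral_congr fun x => ?_
            rw [hh, rieszPotential_bubble, ← hh, ← hκdef]
            ring
    calc rieszEnergy l f * B ≤ (u 0 * L (g k) + err) * B := by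
          gcongr
          exact (hgS k).2.2.2.trans h1
      _ = (u 0 * B) * L (g k) + err * B := by ring
      _ ≤ (κ * L (g k) + err) * L (g k) + err * B := by gcongr
      _ = κ * L (g k) ^ 2 + err * L (g k) + err * B := by ring
      _ ≤ κ * R ^ 2 + err * B + err * B := by
          gcongr
          exact hLB _ (hgS k)
      _ = _ := by ring
  have hfinal := (tendsto_const_nhds (x := κ * R ^ 2)).add
    (ENNReal.Tendsto.const_mul (a := 2 * B) herr (Or.inr (ENNReal.mul_ne_top (by norm_num) hB)))
  rw [mul_zero, add_zero] at hfinal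
  exact ge_of_tendsto' hfinal hbound

theorem lintegral_bubble_ne_zero (e : ℝ) : ∫⁻ x : E, bubble e x ≠ 0 := by
  rw [Ne, lintegral_eq_zero_iff (measurable_bubble e)]
  intro h
  obtain ⟨x, hx⟩ := h.exists
  exact bubble_ne_zero e x hx

/-- The sharp constant in the Hardy-Littlewood-Sobolev inequality. -/
def hlsConst (E : Type*) [NormedAddCommGroup E] [InnerProductSpace ℝ E]
    [MeasurableSpace E] [BorelSpace E] [FiniteDimensional ℝ E] (l : ℝ) : ℝ≥0∞ :=
  rieszPotential l (bubble (2 * (Module.finrank ℝ E : ℝ) - l)) (0 : E) *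
    (∫⁻ x : E, bubble (2 * (Module.finrank ℝ E : ℝ)) x) ^ (l / (Module.finrank ℝ E : ℝ) - 1)

theorem rieszEnergy_le_hlsConst_of_le_bubble {l : ℝ} (hl : 0 < l) (hld : l < 2 * dim)
    (hκ : rieszPotential l (bubble (2 * dim - l)) (0 : E) ≠ ∞)
    (hB : ∫⁻ x : E, bubble (2 * dim) x ≠ ∞)
    {f : E → ℝ≥0∞} (hf : Measurable f) (hfh : ∀ x, f x ≤ bubble (2 * dim - l) x) :
    rieszEnergy l f ≤ hlsConst E l *
      (∫⁻ x, f x ^ (2 * dim / (2 * dim - l))) ^ ((2 * dim - l) / dim) := by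
  have hd : 0 < dim := by linarith
  have h := rieszEnergy_le_of_le_bubble hl hld hκ hB hf hfh
  have hB0 := lintegral_bubble_ne_zero (E := E) (2 * dim)
  rw [hlsConst]
  set B := ∫⁻ x : E, bubble (2 * dim) x
  rw [← ENNReal.le_div_iff_mul_le (Or.inl hB0) (Or.inl hB)] at h
  refine h.trans_eq ?_
  rw [ENNReal.rpow_sub _ _ hB0 hB, ENNReal.rpow_one, mul_pow, ← ENNReal.rpow_natCast,
    ← ENNReal.rpow_natCast, ← ENNReal.rpow_mul, ← ENNReal.rpow_mul]
  have e1 : (2 * dim - l) / (2 * dim) * (2 : ℕ) = (2 * dim - l) / dim := by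
    push_cast; field_simp
  have e2 : l / (2 * dim) * (2 : ℕ) = l / dim := by
    push_cast; field_simp
  rw [e1, e2]
  simp only [div_eq_mul_inv]
  ring

theorem rieszPotential_const_mul {l : ℝ} {c : ℝ≥0∞} {f : E → ℝ≥0∞} (hf : Measurable f) (x : E) :
    rieszPotential l (fun x => c * f x) x = c * rieszPotential l f x := by
  have hK := measurable_rieszKernel_norm_right (E := E) l
  simp_rw [rieszPotential, mul_assoc]
  rw [lintegral_const_mul _ (by fun_prop)]

theorem rieszEnergy_const_mul {l : ℝ} {c : ℝ≥0∞} {f : E → ℝ≥0∞} (hf : Measurable f) :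
    rieszEnergy l (fun x => c * f x) = c ^ 2 * rieszEnergy l f := by
  have := measurable_rieszPotential (l := l) hf
  simp_rw [rieszEnergy, rieszPotential_const_mul hf]
  rw [← lintegral_const_mul _ (by fun_prop)]
  exact lintegral_congr fun x => by ring

theorem rieszEnergy_iSup {l : ℝ} {f : ℕ → E → ℝ≥0∞} (hf : ∀ k, Measurable (f k))
    (hmono : Monotone f) : rieszEnergy l (fun x => ⨆ k, f k x) = ⨆ k, rieszEnergy l (f k) := by
  have hK := measurable_rieszKernel_norm_right (E := E) l
  have hu : ∀ k, Measurable (rieszPotential l (f k)) := fun k => measurable_rieszPotential (hf k)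
  have h1 : ∀ x, rieszPotential l (fun x => ⨆ k, f k x) x = ⨆ k, rieszPotential l (f k) x := by
    intro x
    simp_rw [rieszPotential, ENNReal.iSup_mul]
    exact lintegral_iSup (fun k => by have := hf k; fun_prop)
      fun i j hij y => mul_le_mul_left (hmono hij y) _
  have humono : ∀ x, Monotone fun k => rieszPotential l (f k) x := fun x i j hij =>
    rieszPotential_mono (fun y => hmono hij y) x
  simp_rw [rieszEnergy, h1]
  refine Eq.trans (lintegral_congr fun x => ?_)
    (lintegral_iSup (f := fun k x => f k x * rieszPotential l (f k) x)
      (fun k => (hf k).mul (hu k)) (fun i j hij x => mul_le_mul' (hmono hij x) (humono x hij)))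
  simp_rw [ENNReal.iSup_mul, ENNReal.mul_iSup]
  refine le_antisymm (iSup_le fun i => iSup_le fun j => ?_)
    (iSup_le fun k => le_iSup_of_le k (le_iSup_of_le k le_rfl))
  exact le_iSup_of_le (max i j) (mul_le_mul' (hmono (le_max_left i j) x)
    (humono x (le_max_right i j)))

/-- The sharp Hardy-Littlewood-Sobolev inequality on the diagonal. -/
theorem rieszEnergy_le_hlsConst {l : ℝ} (hl : 0 < l) (hld : l < 2 * dim)
    (hκ : rieszPotential l (bubble (2 * dim - l)) (0 : E) ≠ ∞)
    (hB : ∫⁻ x : E, bubble (2 * dim) x ≠ ∞)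
    {f : E → ℝ≥0∞} (hf : Measurable f) :
    rieszEnergy l f ≤ hlsConst E l *
      (∫⁻ x, f x ^ (2 * dim / (2 * dim - l))) ^ ((2 * dim - l) / dim) := by
  have hd : 0 < dim := by linarith
  have hld' : 0 < 2 * dim - l := by linarith
  have hb := measurable_bubble (E := E) (2 * dim - l)
  set g : ℕ → E → ℝ≥0∞ := fun k x => min (f x) ((k + 1 : ℕ) * bubble (2 * dim - l) x) with hg
  have hgm : ∀ k, Measurable (g k) := fun k => by fun_prop
  have hgmono : Monotone g := fun i j hij x => by
    simp only [hg]
    gcongr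
  have hgf : ∀ k x, g k x ≤ f x := fun k x => min_le_left _ _
  have hsup : f = fun x => ⨆ k, g k x := by
    funext x
    refine le_antisymm ?_ (iSup_le fun k => hgf k x)
    refine le_of_forall_lt fun c hc => ?_
    obtain ⟨k, hk⟩ := ENNReal.exists_nat_mul_gt (bubble_ne_zero (2 * dim - l) x) hc.ne_top
    refine lt_of_lt_of_le (lt_min hc (hk.trans_le ?_)) (le_iSup (fun k => g k x) k)
    gcongr
    exact Nat.le_succ k
  conv_lhs => rw [hsup]
  rw [rieszEnergy_iSup hgm hgmono]
  refine iSup_le fun k => ?_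
  have hc0 : ((k + 1 : ℕ) : ℝ≥0∞) ≠ 0 := by positivity
  have hct : ((k + 1 : ℕ) : ℝ≥0∞) ≠ ∞ := ENNReal.natCast_ne_top _
  set c : ℝ≥0∞ := ((k + 1 : ℕ) : ℝ≥0∞) with hc
  have hgk := hgm k
  have hg' : ∀ x, g k x = c * (c⁻¹ * g k x) := fun x => by
    rw [← mul_assoc, ENNReal.mul_inv_cancel hc0 hct, one_mul]
  have hle := rieszEnergy_le_hlsConst_of_le_bubble hl hld hκ hB (f := fun x => c⁻¹ * g k x)
    (by fun_prop) (fun x => by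
      rw [ENNReal.inv_mul_le_iff hc0 hct]
      exact min_le_right _ _)
  calc rieszEnergy l (g k) = rieszEnergy l (fun x => c * (c⁻¹ * g k x)) := by
        simp_rw [← hg']
    _ = c ^ 2 * rieszEnergy l (fun x => c⁻¹ * g k x) := rieszEnergy_const_mul (by fun_prop)
    _ ≤ c ^ 2 * (hlsConst E l * (∫⁻ x, (c⁻¹ * g k x) ^ (2 * dim / (2 * dim - l))) ^
        ((2 * dim - l) / dim)) := by gcongr
    _ = hlsConst E l * (∫⁻ x, g k x ^ (2 * dim / (2 * dim - l))) ^ ((2 * dim - l) / dim) := by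
        simp_rw [ENNReal.mul_rpow_of_nonneg _ _ (by positivity : 0 ≤ 2 * dim / (2 * dim - l))]
        rw [lintegral_const_mul _ (by fun_prop),
          ENNReal.mul_rpow_of_nonneg _ _ (by positivity : 0 ≤ (2 * dim - l) / dim),
          ← ENNReal.rpow_mul]
        have : 2 * dim / (2 * dim - l) * ((2 * dim - l) / dim) = (2 : ℕ) := by
          push_cast; field_simp
        rw [this, ENNReal.rpow_natCast, mul_left_comm, ← mul_assoc (c ^ 2), ← mul_pow,
          ENNReal.mul_inv_cancel hc0 hct, one_pow, one_mul]
    _ ≤ _ := by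
        gcongr
        exact hgf k _

end SharpHLS

section GammaIntegrals

open Set

theorem lintegral_rpow_mul_exp_neg_mul {a c : ℝ} (ha : 0 < a) (hc : 0 < c) :
    ∫⁻ t in Ioi (0 : ℝ), ENNReal.ofReal (t ^ (a - 1) * Real.exp (-(c * t))) =
      ENNReal.ofReal (Gamma a * c ^ (-a)) := by
  have h := Real.integral_rpow_mul_exp_neg_mul_Ioi ha hc
  have hpos : 0 < (1 / c) ^ a * Gamma a := by have := Gamma_pos_of_pos ha; positivity
  rw [← ofReal_integral_eq_lintegral_ofReal (.of_integral_ne_zero (by rw [h]; exact hpos.ne'))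
    ((ae_restrict_iff' measurableSet_Ioi).2 (.of_forall fun t ht => by
      have := mem_Ioi.1 ht; positivity)), h, one_div, Real.inv_rpow hc.le, Real.rpow_neg hc.le,
    mul_comm]

theorem lintegral_rpow_mul_lintegral_exp {a c : ℝ} (ha : 0 < a) (hc : 0 < c) :
    ENNReal.ofReal (c ^ (-a)) = ENNReal.ofReal (Gamma a)⁻¹ *
      ∫⁻ t in Ioi (0 : ℝ), ENNReal.ofReal (t ^ (a - 1) * Real.exp (-(c * t))) := by
  have := Gamma_pos_of_pos ha
  rw [lintegral_rpow_mul_exp_neg_mul ha hc, ← ENNReal.ofReal_mul (by positivity),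
    inv_mul_cancel_left₀ this.ne']

theorem rieszKernel_eq_lintegral {l t : ℝ} (hl : 0 < l) (ht : 0 < t) :
    rieszKernel l t = ENNReal.ofReal (Gamma (l / 2))⁻¹ *
      ∫⁻ s in Ioi (0 : ℝ), ENNReal.ofReal (s ^ (l / 2 - 1) * Real.exp (-(t ^ 2 * s))) := by
  rw [← lintegral_rpow_mul_lintegral_exp (by positivity) (by positivity), rieszKernel,
    ← ENNReal.ofReal_inv_of_pos (by positivity), ← Real.rpow_neg ht.le, ← Real.rpow_natCast,
    ← Real.rpow_mul ht.le]
  congr 2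
  push_cast
  ring

variable {E : Type*} [NormedAddCommGroup E] [InnerProductSpace ℝ E]
  [MeasurableSpace E] [BorelSpace E] [FiniteDimensional ℝ E]

local notation "dim" => (Module.finrank ℝ E : ℝ)

theorem lintegral_exp_neg_mul_sq_norm {t : ℝ} (ht : 0 < t) :
    ∫⁻ y : E, ENNReal.ofReal (Real.exp (-(‖y‖ ^ 2 * t))) =
      ENNReal.ofReal ((π / t) ^ (dim / 2)) := by
  have h := GaussianFourier.integral_rexp_neg_mul_sq_norm (V := E) ht
  have hpos : 0 < (π / t) ^ (dim / 2) := by positivity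
  simp_rw [show ∀ y : E, -(‖y‖ ^ 2 * t) = -t * ‖y‖ ^ 2 from fun y => by ring]
  rw [← ofReal_integral_eq_lintegral_ofReal (.of_integral_ne_zero (by rw [h]; exact hpos.ne'))
    (.of_forall fun t => by positivity), h]

variable [Nontrivial E]

theorem lintegral_exp_mul_rieszKernel {l t : ℝ} (hl : 0 < l) (hld : l < dim) (ht : 0 < t) :
    ∫⁻ y : E, ENNReal.ofReal (Real.exp (-(‖y‖ ^ 2 * t))) * rieszKernel l ‖y‖ =
      ENNReal.ofReal (π ^ (dim / 2) * Gamma ((dim - l) / 2) / Gamma (dim / 2) *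
        t ^ (-((dim - l) / 2))) := by
  have hd : 0 < dim := hl.trans hld
  have hG1 := Gamma_pos_of_pos (half_pos hl)
  have hG2 := Gamma_pos_of_pos (half_pos hd)
  have hG3 := Gamma_pos_of_pos (half_pos (sub_pos.2 hld))
  calc
    _ = ∫⁻ y : E, ENNReal.ofReal (Gamma (l / 2))⁻¹ * ∫⁻ s in Ioi (0 : ℝ),
        ENNReal.ofReal (s ^ (l / 2 - 1) * Real.exp (-(‖y‖ ^ 2 * (s + t)))) := by
      refine lintegral_congr_ae ?_
      filter_upwards [ae_ne (0 : E)] with y hy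
      rw [rieszKernel_eq_lintegral hl (norm_pos_iff.2 hy), mul_left_comm,
        ← lintegral_const_mul _ (by fun_prop)]
      congr 1
      refine setLIntegral_congr_fun measurableSet_Ioi fun s hs => ?_
      have := mem_Ioi.1 hs
      rw [← ENNReal.ofReal_mul (by positivity), mul_left_comm, ← Real.exp_add]
      ring_nf
    _ = ENNReal.ofReal (Gamma (l / 2))⁻¹ * ∫⁻ s in Ioi (0 : ℝ), ENNReal.ofReal (s ^ (l / 2 - 1)) *
        ENNReal.ofReal ((π / (s + t)) ^ (dim / 2)) := by
      rw [lintegral_const_mul _ (by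
        refine Measurable.lintegral_prod_right' (f := fun z : E × ℝ =>
          ENNReal.ofReal (z.2 ^ (l / 2 - 1) * Real.exp (-(‖z.1‖ ^ 2 * (z.2 + t))))) ?_
        fun_prop),
        lintegral_lintegral_swap (by fun_prop)]
      congr 1
      refine setLIntegral_congr_fun measurableSet_Ioi fun s hs => ?_
      have hs := mem_Ioi.1 hs
      rw [← lintegral_exp_neg_mul_sq_norm (by positivity), ← lintegral_const_mul _ (by fun_prop)]
      refine lintegral_congr fun y => ?_
      rw [← ENNReal.ofReal_mul (by positivity)]
    _ = ENNReal.ofReal (Gamma (l / 2))⁻¹ * ∫⁻ s in Ioi (0 : ℝ),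
        ENNReal.ofReal (π ^ (dim / 2) * (Gamma (dim / 2))⁻¹) * ∫⁻ r in Ioi (0 : ℝ),
          ENNReal.ofReal (r ^ (dim / 2 - 1) * Real.exp (-(t * r))) *
            ENNReal.ofReal (s ^ (l / 2 - 1) * Real.exp (-(r * s))) := by
      congr 1
      refine setLIntegral_congr_fun measurableSet_Ioi fun s hs => ?_
      have hs := mem_Ioi.1 hs
      have hst : 0 < s + t := by positivity
      rw [Real.div_rpow pi_pos.le hst.le, div_eq_mul_inv (π ^ _), ← Real.rpow_neg hst.le,
        ENNReal.ofReal_mul (by positivity), lintegral_rpow_mul_lintegral_exp (half_pos hd) hst,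
        ENNReal.ofReal_mul (by positivity), mul_left_comm, mul_assoc,
        mul_left_comm (ENNReal.ofReal (s ^ _)),
        ← lintegral_const_mul _ (by fun_prop)]
      congr 2
      refine setLIntegral_congr_fun measurableSet_Ioi fun r hr => ?_
      have := mem_Ioi.1 hr
      rw [← ENNReal.ofReal_mul (by positivity), ← ENNReal.ofReal_mul (by positivity)]
      rw [show -((s + t) * r) = -(t * r) + -(r * s) by ring, Real.exp_add]
      congr 1
      ring
    _ = ENNReal.ofReal (Gamma (l / 2))⁻¹ * (ENNReal.ofReal (π ^ (dim / 2) * (Gamma (dim / 2))⁻¹) *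
        ∫⁻ r in Ioi (0 : ℝ), ENNReal.ofReal (Gamma (l / 2)) *
          ENNReal.ofReal (r ^ ((dim - l) / 2 - 1) * Real.exp (-(t * r)))) := by
      congr 1
      rw [lintegral_const_mul _ (by
        refine Measurable.lintegral_prod_right' (f := fun z : ℝ × ℝ =>
          ENNReal.ofReal (z.2 ^ (dim / 2 - 1) * Real.exp (-(t * z.2))) *
            ENNReal.ofReal (z.1 ^ (l / 2 - 1) * Real.exp (-(z.2 * z.1)))) ?_
        fun_prop), lintegral_lintegral_swap (by fun_prop)]
      congr 1
      refine setLIntegral_congr_fun measurableSet_Ioi fun r hr => ?_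
      have hr := mem_Ioi.1 hr
      rw [lintegral_const_mul _ (by fun_prop), lintegral_rpow_mul_exp_neg_mul (half_pos hl) hr,
        ← ENNReal.ofReal_mul (by positivity), ← ENNReal.ofReal_mul (by positivity),
        show (dim - l) / 2 - 1 = dim / 2 - 1 + -(l / 2) by ring, Real.rpow_add hr]
      congr 1
      ring
    _ = _ := by
      rw [lintegral_const_mul _ (by fun_prop),
        lintegral_rpow_mul_exp_neg_mul (half_pos (sub_pos.2 hld)) ht,
        ← ENNReal.ofReal_mul (by positivity), ← ENNReal.ofReal_mul (by positivity),
        ← ENNReal.ofReal_mul (by positivity)]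
      congr 1
      field_simp

theorem bubble_eq_lintegral {a : ℝ} (ha : 0 < a) (x : E) :
    bubble (2 * a) x = ENNReal.ofReal (Gamma a)⁻¹ *
      ∫⁻ r in Ioi (0 : ℝ), ENNReal.ofReal (r ^ (a - 1) * Real.exp (-(1 * r))) *
        ENNReal.ofReal (Real.exp (-(‖x‖ ^ 2 * r))) := by
  rw [bubble, mul_div_cancel_left₀ a two_ne_zero,
    lintegral_rpow_mul_lintegral_exp ha (by positivity)]
  congr 1
  refine setLIntegral_congr_fun measurableSet_Ioi fun r hr => ?_
  have hr := mem_Ioi.1 hr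
  rw [← ENNReal.ofReal_mul (by positivity), add_mul, neg_add, Real.exp_add, mul_assoc]

theorem lintegral_bubble_mul_of_gaussian {a b c : ℝ} (hab : b < a) (hb : 0 < b)
    (hc : 0 ≤ c) {w : E → ℝ≥0∞} (hw : Measurable w)
    (h : ∀ t : ℝ, 0 < t → ∫⁻ y : E, ENNReal.ofReal (Real.exp (-(‖y‖ ^ 2 * t))) * w y =
      ENNReal.ofReal (c * t ^ (-b))) :
    ∫⁻ y : E, bubble (2 * a) y * w y = ENNReal.ofReal (c * Gamma (a - b) / Gamma a) := by
  have ha : 0 < a := hb.trans hab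
  have hG := Gamma_pos_of_pos ha
  have hm : Measurable fun z : E × ℝ => ENNReal.ofReal (z.2 ^ (a - 1) * Real.exp (-(1 * z.2))) *
      ENNReal.ofReal (Real.exp (-(‖z.1‖ ^ 2 * z.2))) * w z.1 := by fun_prop
  calc
    _ = ∫⁻ y : E, ENNReal.ofReal (Gamma a)⁻¹ * ∫⁻ r in Ioi (0 : ℝ),
        ENNReal.ofReal (r ^ (a - 1) * Real.exp (-(1 * r))) *
          ENNReal.ofReal (Real.exp (-(‖y‖ ^ 2 * r))) * w y :=
      lintegral_congr fun y => by
        rw [bubble_eq_lintegral ha, lintegral_mul_const _ (by fun_prop), mul_assoc]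
    _ = ENNReal.ofReal (Gamma a)⁻¹ * ∫⁻ r in Ioi (0 : ℝ),
        ENNReal.ofReal c * ENNReal.ofReal (r ^ (a - b - 1) * Real.exp (-(1 * r))) := by
      rw [lintegral_const_mul _ hm.lintegral_prod_right',
        lintegral_lintegral_swap hm.aemeasurable]
      congr 1
      refine setLIntegral_congr_fun measurableSet_Ioi fun r hr => ?_
      have hr := mem_Ioi.1 hr
      simp_rw [mul_assoc (ENNReal.ofReal (r ^ (a - 1) * _))]
      rw [lintegral_const_mul _ (by fun_prop), h r hr, ← ENNReal.ofReal_mul (by positivity),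
        ← ENNReal.ofReal_mul (by positivity), show a - b - 1 = a - 1 + -b by ring,
        Real.rpow_add hr]
      congr 1
      ring
    _ = _ := by
      rw [lintegral_const_mul _ (by fun_prop),
        lintegral_rpow_mul_exp_neg_mul (sub_pos.2 hab) one_pos, Real.one_rpow, mul_one,
        ← ENNReal.ofReal_mul (by positivity), ← ENNReal.ofReal_mul (by positivity)]
      congr 1
      field_simp

theorem rieszPotential_bubble_zero {l : ℝ} (hl : 0 < l) (hld : l < dim) :
    rieszPotential l (bubble (2 * dim - l)) (0 : E) =
      ENNReal.ofReal (π ^ (dim / 2) * Gamma ((dim - l) / 2) / Gamma (dim - l / 2)) := by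
  have hd : 0 < dim := hl.trans hld
  have hG2 := Gamma_pos_of_pos (half_pos hd)
  have hG3 := Gamma_pos_of_pos (half_pos (sub_pos.2 hld))
  have h := lintegral_bubble_mul_of_gaussian (E := E) (a := dim - l / 2) (b := (dim - l) / 2)
    (by linarith) (by linarith) (by positivity) (by have := measurable_rieszKernel l; fun_prop)
    fun t ht => lintegral_exp_mul_rieszKernel hl hld ht
  simp only [rieszPotential, zero_sub, norm_neg]
  rw [show 2 * dim - l = 2 * (dim - l / 2) by ring, h]
  rw [show dim - l / 2 - (dim - l) / 2 = dim / 2 by ring]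
  congr 1
  field_simp

theorem lintegral_bubble_two_mul_dim :
    ∫⁻ x : E, bubble (2 * dim) x =
      ENNReal.ofReal (π ^ (dim / 2) * Gamma (dim / 2) / Gamma dim) := by
  have hd : 0 < dim := by exact_mod_cast Module.finrank_pos
  have h := lintegral_bubble_mul_of_gaussian (E := E) (a := dim) (b := dim / 2)
    (by linarith) (by linarith) (c := π ^ (dim / 2)) (by positivity) (w := fun _ => 1) (by fun_prop)
    fun t ht => by
      simp_rw [mul_one]
      rw [lintegral_exp_neg_mul_sq_norm ht, Real.div_rpow pi_pos.le ht.le, Real.rpow_neg ht.le,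
        div_eq_mul_inv]
  simp_rw [mul_one] at h
  rw [h, sub_half]

end GammaIntegrals

section FourierEnergy

open scoped FourierTransform ComplexConjugate

/-- The character `t ↦ e^{-2πit}`. -/
def fourierPhase (t : ℝ) : ℂ := Complex.exp ((-2 * π * t : ℝ) * Complex.I)

theorem norm_fourierPhase (t : ℝ) : ‖fourierPhase t‖ = 1 := Complex.norm_exp_ofReal_mul_I _

theorem continuous_fourierPhase : Continuous fourierPhase := by unfold fourierPhase; fun_prop

theorem fourierPhase_add (s t : ℝ) : fourierPhase (s + t) = fourierPhase s * fourierPhase t := by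
  simp only [fourierPhase, ← Complex.exp_add]
  push_cast
  ring_nf

theorem fourierPhase_zero : fourierPhase 0 = 1 := by simp [fourierPhase]

theorem fourierPhase_sum {ι : Type*} (s : Finset ι) (t : ι → ℝ) :
    fourierPhase (∑ i ∈ s, t i) = ∏ i ∈ s, fourierPhase (t i) := by
  induction s using Finset.cons_induction with
  | empty => simp [fourierPhase_zero]
  | cons a s ha ih => rw [Finset.sum_cons, Finset.prod_cons, fourierPhase_add, ih]

theorem conj_fourierPhase (t : ℝ) : conj (fourierPhase t) = fourierPhase (-t) := by
  simp [fourierPhase, ← Complex.exp_conj, map_ofNat]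

variable {E : Type*} [NormedAddCommGroup E] [InnerProductSpace ℝ E]
  [MeasurableSpace E] [BorelSpace E] [FiniteDimensional ℝ E]

theorem fourier_eq_integral_fourierPhase (f : E → ℂ) (w : E) :
    𝓕 f w = ∫ v, fourierPhase ⟪v, w⟫_ℝ * f v := Real.fourier_eq' f w

theorem continuous_fourier {f : E → ℂ} (hf : Integrable f) : Continuous (𝓕 f) :=
  VectorFourier.fourierIntegral_continuous Real.continuous_fourierChar
    (by exact continuous_inner) hf

variable {ι : Type*} [Fintype ι]

/-- The integrand of the joint Fubini argument behind `integral_norm_sq_fourier_sum_mul_prod`. -/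
theorem integrable_fourierPhase_mul_prod {g : E → ℂ} (hg : Integrable g) {k : ι → E → ℂ}
    (hk : ∀ i, Integrable (k i)) :
    Integrable (fun z : (E × E) × (ι → E) => fourierPhase ⟪z.1.1 - z.1.2, ∑ i, z.2 i⟫_ℝ *
      (g z.1.1 * conj (g z.1.2) * ∏ i, k i (z.2 i))) := by
  have hg' : Integrable fun y => conj (g y) := by
    simpa using (Complex.conjCLE.toContinuousLinearMap).integrable_comp hg
  have h := (hg.mul_prod hg').mul_prod (Integrable.fintype_prod hk)
  refine h.bdd_mul (c := 1) ?_ (.of_forall fun z => (norm_fourierPhase _).le)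
  exact (continuous_fourierPhase.comp (by fun_prop)).aestronglyMeasurable

theorem integral_fourierPhase_mul_prod (k : ι → E → ℂ) (x : E) :
    ∫ ξ : ι → E, fourierPhase ⟪x, ∑ i, ξ i⟫_ℝ * ∏ i, k i (ξ i) = ∏ i, 𝓕 (k i) x := by
  simp_rw [inner_sum, fourierPhase_sum, ← Finset.prod_mul_distrib]
  rw [integral_fintype_prod_volume_eq_prod (fun i ξ => fourierPhase ⟪x, ξ⟫_ℝ * k i ξ)]
  refine Finset.prod_congr rfl fun i _ => ?_
  rw [fourier_eq_integral_fourierPhase]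
  simp_rw [real_inner_comm]

theorem integrable_mul_conj_mul_prod_fourier {g : E → ℂ} (hg : Integrable g) {k : ι → E → ℂ}
    (hk : ∀ i, Integrable (k i)) :
    Integrable (fun z : E × E => g z.1 * conj (g z.2) * ∏ i, 𝓕 (k i) (z.1 - z.2)) := by
  refine (integrable_fourierPhase_mul_prod hg hk).integral_prod_left.congr (.of_forall fun z => ?_)
  simp only [mul_left_comm (fourierPhase _)]
  rw [integral_const_mul, integral_fourierPhase_mul_prod]

theorem integral_norm_sq_fourier_sum_mul_prod {g : E → ℂ} (hg : Integrable g) {k : ι → E → ℂ}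
    (hk : ∀ i, Integrable (k i)) :
    ∫ ξ : ι → E, (‖𝓕 g (∑ i, ξ i)‖ ^ 2 : ℝ) * ∏ i, k i (ξ i) =
      ∫ z : E × E, g z.1 * conj (g z.2) * ∏ i, 𝓕 (k i) (z.1 - z.2) := by
  have hsw := integral_integral_swap (μ := (volume : Measure (E × E)))
    (ν := (volume : Measure (ι → E))) (f := fun z ξ =>
      fourierPhase ⟪z.1 - z.2, ∑ i, ξ i⟫_ℝ * (g z.1 * conj (g z.2) * ∏ i, k i (ξ i)))
      (integrable_fourierPhase_mul_prod hg hk)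
  calc
    _ = ∫ ξ : ι → E, ∫ z : E × E, fourierPhase ⟪z.1 - z.2, ∑ i, ξ i⟫_ℝ *
        (g z.1 * conj (g z.2) * ∏ i, k i (ξ i)) := by
      refine integral_congr_ae (.of_forall fun ξ => ?_)
      have hc : conj (𝓕 g (∑ i, ξ i)) =
          ∫ y, fourierPhase (-⟪y, ∑ i, ξ i⟫_ℝ) * conj (g y) := by
        rw [fourier_eq_integral_fourierPhase, ← integral_conj]
        simp_rw [map_mul, conj_fourierPhase]
      beta_reduce
      rw [Complex.ofReal_pow, ← Complex.mul_conj', hc, fourier_eq_integral_fourierPhase,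
        ← integral_prod_mul (fun x => fourierPhase ⟪x, ∑ i, ξ i⟫_ℝ * g x)
          fun y => fourierPhase (-⟪y, ∑ i, ξ i⟫_ℝ) * conj (g y), ← integral_mul_const]
      refine integral_congr_ae (.of_forall fun z => ?_)
      beta_reduce
      rw [inner_sub_left, sub_eq_add_neg, fourierPhase_add]
      ring
    _ = _ := by
      rw [← hsw]
      refine integral_congr_ae (.of_forall fun z => ?_)
      simp only [mul_left_comm (fourierPhase _)]
      rw [integral_const_mul, integral_fourierPhase_mul_prod]

end FourierEnergy

section TruncatedKernel

open scoped FourierTransform Topology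
open Set Filter

/-- An exhaustion of `(0, ∞)` by bounded intervals away from `0`. -/
def window (N : ℕ) : Set ℝ := Ioo (1 / ((N : ℝ) + 1)) (N + 1)

theorem window_pos {N : ℕ} {s : ℝ} (hs : s ∈ window N) : 0 < s :=
  lt_trans (by positivity) hs.1

theorem measurableSet_window (N : ℕ) : MeasurableSet (window N) := measurableSet_Ioo

theorem monotone_window : Monotone window := fun N M h => by
  have h' : (N : ℝ) ≤ M := by exact_mod_cast h
  refine Ioo_subset_Ioo ?_ (by linarith)
  gcongr

theorem iUnion_window : ⋃ N, window N = Ioi 0 := by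
  refine subset_antisymm (iUnion_subset fun N s hs => window_pos hs) fun s hs => ?_
  have hs : 0 < s := hs
  obtain ⟨N, hN⟩ := exists_nat_gt (max s (1 / s))
  refine mem_iUnion.2 ⟨N, ?_, ?_⟩
  · rw [one_div_lt (by positivity) hs]
    linarith [le_max_right s (1 / s)]
  · linarith [le_max_left s (1 / s)]

theorem monotone_integral_window {φ : ℝ → ℝ} (h0 : ∀ s, 0 < s → 0 ≤ φ s)
    (hφ : IntegrableOn φ (Ioi 0)) : Monotone fun N => ∫ s in window N, φ s := fun _ M h =>
  setIntegral_mono_set (hφ.mono_set fun _ hs => window_pos hs)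
    ((ae_restrict_iff' (measurableSet_window M)).2 (.of_forall fun s hs => h0 s (window_pos hs)))
    (monotone_window h).eventuallyLE

theorem tendsto_integral_window {φ : ℝ → ℝ} (hφ : IntegrableOn φ (Ioi 0)) :
    Tendsto (fun N => ∫ s in window N, φ s) atTop (𝓝 (∫ s in Ioi 0, φ s)) := by
  rw [← iUnion_window]
  exact tendsto_setIntegral_of_monotone measurableSet_window monotone_window
    (by rwa [iUnion_window])

theorem integral_rpow_mul_exp_neg_div {a b c : ℝ} (hb : 0 < b) (hc : 0 < c) :
    ∫ s in Ioi (0 : ℝ), s ^ (a - 1) * (s⁻¹ ^ (a + b) * Real.exp (-(c / s))) =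
      (1 / c) ^ b * Gamma b := by
  rw [← Real.integral_rpow_mul_exp_neg_mul_Ioi hb hc,
    ← integral_comp_rpow_Ioi (fun t : ℝ => t ^ (b - 1) * Real.exp (-(c * t)))
      (neg_ne_zero.2 one_ne_zero)]
  refine setIntegral_congr_fun measurableSet_Ioi fun s hs => ?_
  have hs : 0 < s := hs
  simp only [smul_eq_mul, abs_neg, abs_one, one_mul]
  rw [← mul_assoc, ← mul_assoc, Real.rpow_neg_one, ← div_eq_mul_inv]
  congr 1
  rw [← Real.rpow_neg_one s, ← Real.rpow_mul hs.le, ← Real.rpow_mul hs.le, ← Real.rpow_add hs,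
    ← Real.rpow_add hs]
  ring_nf

variable {E : Type*} [NormedAddCommGroup E] [InnerProductSpace ℝ E]
  [MeasurableSpace E] [BorelSpace E] [FiniteDimensional ℝ E]

local notation "dim" => (Module.finrank ℝ E : ℝ)

/-- Truncated Gaussian superposition increasing to `‖x‖ ^ (-β)`. -/
def truncKernel (β : ℝ) (N : ℕ) (x : E) : ℝ :=
  π ^ (β / 2) / Gamma (β / 2) *
    ∫ s in window N, s ^ (β / 2 - 1) * Real.exp (-(π * ‖x‖ ^ 2 * s))

/-- The Fourier transform of `truncKernel`. -/
def truncKernelFourier (β : ℝ) (N : ℕ) (x : E) : ℝ :=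
  π ^ (β / 2) / Gamma (β / 2) *
    ∫ s in window N, s ^ (β / 2 - 1) * (s⁻¹ ^ (dim / 2) * Real.exp (-(π * ‖x‖ ^ 2 / s)))

/-- The constant relating `‖x‖ ^ (-β)` to the Fourier transform of `‖ξ‖ ^ (β - d)`. -/
def rieszGamma (d β : ℝ) : ℝ := π ^ (β - d / 2) * Gamma ((d - β) / 2) / Gamma (β / 2)

theorem rieszGamma_pos {d β : ℝ} (hβ : 0 < β) (hβd : β < d) : 0 < rieszGamma d β := by
  have h1 := Gamma_pos_of_pos (half_pos hβ)
  have h2 := Gamma_pos_of_pos (half_pos (sub_pos.2 hβd))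
  unfold rieszGamma
  positivity

theorem truncKernel_nonneg {β : ℝ} (hβ : 0 < β) (N : ℕ) (x : E) : 0 ≤ truncKernel β N x := by
  have h1 := Gamma_pos_of_pos (half_pos hβ)
  refine mul_nonneg (by positivity) (setIntegral_nonneg (measurableSet_window N) fun s hs => ?_)
  have := window_pos hs
  positivity

theorem truncKernelFourier_nonneg {β : ℝ} (hβ : 0 < β) (N : ℕ) (x : E) :
    0 ≤ truncKernelFourier β N x := by
  have h1 := Gamma_pos_of_pos (half_pos hβ)
  refine mul_nonneg (by positivity) (setIntegral_nonneg (measurableSet_window N) fun s hs => ?_)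
  have := window_pos hs
  positivity

theorem truncKernel_monotone_and_tendsto {β : ℝ} (hβ : 0 < β) {x : E} (hx : x ≠ 0) :
    Monotone (fun N => ENNReal.ofReal (truncKernel β N x)) ∧
      Tendsto (fun N => ENNReal.ofReal (truncKernel β N x)) atTop
        (𝓝 (rieszKernel β ‖x‖)) := by
  have h1 := Gamma_pos_of_pos (half_pos hβ)
  have hn : 0 < ‖x‖ := norm_pos_iff.2 hx
  have hc : 0 < π * ‖x‖ ^ 2 := by positivity
  have hI := Real.integral_rpow_mul_exp_neg_mul_Ioi (half_pos hβ) hc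
  have hint : IntegrableOn (fun s => s ^ (β / 2 - 1) * Real.exp (-(π * ‖x‖ ^ 2 * s))) (Ioi 0) :=
    .of_integral_ne_zero (by rw [hI]; positivity)
  refine ⟨fun N M h => ENNReal.ofReal_le_ofReal (mul_le_mul_of_nonneg_left
    (monotone_integral_window (fun s hs => by positivity) hint h) (by positivity)), ?_⟩
  convert (ENNReal.continuous_ofReal.tendsto _).comp
    ((tendsto_integral_window hint).const_mul (π ^ (β / 2) / Gamma (β / 2))) using 2
  · rfl
  rw [hI, rieszKernel, ← ENNReal.ofReal_inv_of_pos (by positivity)]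
  congr 1
  rw [one_div, Real.inv_rpow hc.le, Real.mul_rpow pi_pos.le (by positivity), ← Real.rpow_natCast,
    ← Real.rpow_mul hn.le]
  push_cast
  rw [mul_div_cancel₀ β two_ne_zero]
  field_simp

theorem truncKernelFourier_monotone_and_tendsto {β : ℝ} (hβ : 0 < β) (hβd : β < dim)
    {x : E} (hx : x ≠ 0) :
    Monotone (fun N => ENNReal.ofReal (truncKernelFourier β N x)) ∧
      Tendsto (fun N => ENNReal.ofReal (truncKernelFourier β N x)) atTop
        (𝓝 (ENNReal.ofReal (rieszGamma dim β) * rieszKernel (dim - β) ‖x‖)) := by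
  have h1 := Gamma_pos_of_pos (half_pos hβ)
  have h2 := Gamma_pos_of_pos (half_pos (sub_pos.2 hβd))
  have hγ := rieszGamma_pos hβ hβd
  have hn : 0 < ‖x‖ := norm_pos_iff.2 hx
  have hc : 0 < π * ‖x‖ ^ 2 := by positivity
  have hI := integral_rpow_mul_exp_neg_div (a := β / 2) (half_pos (sub_pos.2 hβd)) hc
  rw [show β / 2 + (dim - β) / 2 = dim / 2 by ring] at hI
  have hint : IntegrableOn (fun s => s ^ (β / 2 - 1) *
      (s⁻¹ ^ (dim / 2) * Real.exp (-(π * ‖x‖ ^ 2 / s)))) (Ioi 0) :=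
    .of_integral_ne_zero (by rw [hI]; positivity)
  refine ⟨fun N M h => ENNReal.ofReal_le_ofReal (mul_le_mul_of_nonneg_left
    (monotone_integral_window (fun s hs => by positivity) hint h) (by positivity)), ?_⟩
  convert (ENNReal.continuous_ofReal.tendsto _).comp
    ((tendsto_integral_window hint).const_mul (π ^ (β / 2) / Gamma (β / 2))) using 2
  · rfl
  rw [hI, rieszKernel, ← ENNReal.ofReal_inv_of_pos (by positivity),
    ← ENNReal.ofReal_mul hγ.le]
  congr 1
  rw [one_div, Real.inv_rpow hc.le, Real.mul_rpow pi_pos.le (by positivity), ← Real.rpow_natCast,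
    ← Real.rpow_mul hn.le, rieszGamma, show β - dim / 2 = β / 2 - (dim - β) / 2 by ring,
    Real.rpow_sub pi_pos]
  push_cast
  rw [mul_div_cancel₀ (dim - β) two_ne_zero]
  field_simp

theorem integrable_window_prod (β : ℝ) (N : ℕ) :
    Integrable (fun z : E × ℝ => z.2 ^ (β / 2 - 1) * Real.exp (-(π * ‖z.1‖ ^ 2 * z.2)))
      ((volume : Measure E).prod (volume.restrict (window N))) := by
  have hN : (0 : ℝ) < 1 / ((N : ℝ) + 1) := by positivity
  have h1 : IntegrableOn (fun s : ℝ => s ^ (β / 2 - 1)) (window N) := by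
    refine (ContinuousOn.integrableOn_compact isCompact_Icc fun s hs => ?_).mono_set
      Ioo_subset_Icc_self
    exact (Real.continuousAt_rpow_const _ _ (.inl (hN.trans_le hs.1).ne')).continuousWithinAt
  have h2 : Integrable fun x : E => Real.exp (-(π * (1 / ((N : ℝ) + 1))) * ‖x‖ ^ 2) :=
    .of_integral_ne_zero (by
      rw [GaussianFourier.integral_rexp_neg_mul_sq_norm (by positivity)]; positivity)
  refine (h2.mul_prod h1).mono' (by fun_prop) ?_
  have : ∀ᵐ z : E × ℝ ∂(volume : Measure E).prod (volume.restrict (window N)),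
      z.2 ∈ window N := Measure.quasiMeasurePreserving_snd.ae
        (ae_restrict_mem (measurableSet_window N))
  filter_upwards [this] with z hz
  have hz0 := window_pos hz
  rw [Real.norm_of_nonneg (by positivity), mul_comm]
  gcongr
  have : 1 / ((N : ℝ) + 1) ≤ z.2 := hz.1.le
  have h3 := mul_le_mul_of_nonneg_left this (show 0 ≤ π * ‖z.1‖ ^ 2 by positivity)
  linarith

theorem integrable_truncKernel (β : ℝ) (N : ℕ) : Integrable (truncKernel (E := E) β N) :=
  (integrable_window_prod β N).integral_prod_left.const_mul _

theorem fourier_ofReal_exp_neg {s : ℝ} (hs : 0 < s) (w : E) :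
    𝓕 (fun v : E => (Real.exp (-(π * ‖v‖ ^ 2 * s)) : ℂ)) w =
      (s⁻¹ ^ (dim / 2) * Real.exp (-(π * ‖w‖ ^ 2 / s)) : ℝ) := by
  have h := fourier_gaussian_innerProductSpace (V := E) (b := ((π * s : ℝ) : ℂ))
    (by rw [Complex.ofReal_re]; positivity) w
  rw [show (fun v : E => (Real.exp (-(π * ‖v‖ ^ 2 * s)) : ℂ)) =
    fun v : E => Complex.exp (-((π * s : ℝ) : ℂ) * ‖v‖ ^ 2) by
      ext v; push_cast; ring_nf, h]
  push_cast
  rw [Complex.ofReal_cpow (by positivity)]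
  push_cast
  congr 2
  · have := pi_ne_zero
    field_simp
  · have := pi_ne_zero
    field_simp

theorem fourier_truncKernel (β : ℝ) (N : ℕ) (w : E) :
    𝓕 (fun v : E => (truncKernel β N v : ℂ)) w = (truncKernelFourier β N w : ℂ) := by
  have hsw : Integrable (fun z : E × ℝ => fourierPhase ⟪z.1, w⟫_ℝ *
      ((z.2 ^ (β / 2 - 1) * Real.exp (-(π * ‖z.1‖ ^ 2 * z.2)) : ℝ) : ℂ))
      ((volume : Measure E).prod (volume.restrict (window N))) :=
    (integrable_window_prod β N).ofReal.bdd_mul (c := 1)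
      (continuous_fourierPhase.comp (by fun_prop)).aestronglyMeasurable
      (.of_forall fun z => (norm_fourierPhase _).le)
  rw [fourier_eq_integral_fourierPhase]
  simp only [truncKernel, truncKernelFourier, Complex.ofReal_mul]
  simp_rw [mul_left_comm (fourierPhase _)]
  rw [integral_const_mul]
  congr 1
  simp_rw [← integral_complex_ofReal, ← integral_const_mul]
  rw [integral_integral_swap hsw]
  refine setIntegral_congr_fun (measurableSet_window N) fun s hs => ?_
  simp only [Complex.ofReal_mul]
  simp_rw [mul_left_comm (fourierPhase _)]
  rw [integral_const_mul, ← fourier_eq_integral_fourierPhase,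
    fourier_ofReal_exp_neg (window_pos hs)]
  push_cast
  rfl

end TruncatedKernel

section EnergyIdentity

open scoped FourierTransform ComplexConjugate Topology
open Filter

variable {E : Type*} [NormedAddCommGroup E] [InnerProductSpace ℝ E]
  [MeasurableSpace E] [BorelSpace E] [FiniteDimensional ℝ E]

local notation "dim" => (Module.finrank ℝ E : ℝ)

variable {ι : Type*} [Fintype ι]

/-- The weighted energy `∫ |ĝ(∑ ξ_i)|² ∏ |ξ_i|^{-β_i} dξ`. -/
def fourierEnergy (β : ι → ℝ) (g : E → ℂ) : ℝ≥0∞ :=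
  ∫⁻ ξ : ι → E, ‖𝓕 g (∑ i, ξ i)‖ₑ ^ 2 * ∏ i, rieszKernel (β i) ‖ξ i‖

theorem norm_fourier_le (g : E → ℂ) (w : E) : ‖𝓕 g w‖ ≤ ∫ x, ‖g x‖ :=
  VectorFourier.norm_fourierIntegral_le_integral_norm _ _ _ g w

theorem lintegral_norm_sq_fourier_mul_truncKernel {β : ι → ℝ} (hβ : ∀ i, 0 < β i) {g : E → ℂ}
    (hg : Integrable g) (N : ℕ) :
    ∫⁻ ξ : ι → E, ‖𝓕 g (∑ i, ξ i)‖ₑ ^ 2 * ∏ i, ENNReal.ofReal (truncKernel (β i) N (ξ i)) =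
      ‖∫ z : E × E, g z.1 * conj (g z.2) *
        ((∏ i, truncKernelFourier (β i) N (z.1 - z.2) : ℝ) : ℂ)‖ₑ := by
  have hk : ∀ i, Integrable fun v : E => (truncKernel (β i) N v : ℂ) := fun i =>
    (integrable_truncKernel (β i) N).ofReal
  have h := integral_norm_sq_fourier_sum_mul_prod hg hk
  simp_rw [fourier_truncKernel, ← Complex.ofReal_prod, ← Complex.ofReal_mul] at h
  rw [← h, integral_complex_ofReal, ← ofReal_norm, Complex.norm_real]
  have h0 : ∀ ξ : ι → E, 0 ≤ ‖𝓕 g (∑ i, ξ i)‖ ^ 2 * ∏ i, truncKernel (β i) N (ξ i) := fun ξ =>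
    mul_nonneg (by positivity) (Finset.prod_nonneg fun i _ => truncKernel_nonneg (hβ i) _ _)
  rw [Real.norm_of_nonneg (integral_nonneg h0),
    ofReal_integral_eq_lintegral_ofReal _ (.of_forall h0)]
  · refine lintegral_congr fun ξ => ?_
    rw [ENNReal.ofReal_mul (by positivity), ENNReal.ofReal_pow (by positivity),
      ofReal_norm, ENNReal.ofReal_prod_of_nonneg fun i _ => truncKernel_nonneg (hβ i) _ _]
  · refine (Integrable.fintype_prod fun i => integrable_truncKernel (β i) N).bdd_mul
      (c := (∫ x, ‖g x‖) ^ 2) ?_ (.of_forall fun ξ => ?_)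
    · have := continuous_fourier hg
      exact Continuous.aestronglyMeasurable (by fun_prop)
    · rw [Real.norm_of_nonneg (by positivity)]
      gcongr
      exact norm_fourier_le g _

theorem prod_rieszKernel {l : ι → ℝ} {t : ℝ} (ht : 0 < t) :
    ∏ i, rieszKernel (l i) t = rieszKernel (∑ i, l i) t := by
  simp only [rieszKernel]
  rw [Real.rpow_sum_of_pos ht,
    ENNReal.ofReal_prod_of_nonneg fun i _ => Real.rpow_nonneg ht.le _,
    ENNReal.prod_inv_distrib fun i _ j _ _ => .inr ENNReal.ofReal_ne_top]

theorem rieszKernel_ne_top {l t : ℝ} (ht : 0 < t) : rieszKernel l t ≠ ∞ := by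
  rw [rieszKernel, ENNReal.inv_ne_top]
  exact (ENNReal.ofReal_pos.2 (Real.rpow_pos_of_pos ht l)).ne'

variable [Nontrivial E]

theorem ae_forall_ne_zero : ∀ᵐ ξ : ι → E, ∀ i, ξ i ≠ 0 :=
  ae_all_iff.2 fun i => (Measure.quasiMeasurePreserving_eval
    (fun _ : ι => (volume : Measure E)) i).ae (ae_ne (0 : E))

theorem tendsto_fourierEnergy {β : ι → ℝ} (hβ : ∀ i, 0 < β i) {g : E → ℂ}
    (hg : Integrable g) :
    Tendsto (fun N => ∫⁻ ξ : ι → E, ‖𝓕 g (∑ i, ξ i)‖ₑ ^ 2 *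
      ∏ i, ENNReal.ofReal (truncKernel (β i) N (ξ i))) atTop (𝓝 (fourierEnergy β g)) := by
  have hc := continuous_fourier hg
  refine lintegral_tendsto_of_tendsto_of_monotone (fun N => ?_) ?_ ?_
  · have h1 : AEMeasurable fun ξ : ι → E => ‖𝓕 g (∑ i, ξ i)‖ₑ ^ 2 :=
      Continuous.aemeasurable (by fun_prop)
    refine h1.mul (Finset.aemeasurable_fun_prod _ fun i _ => ?_)
    exact ((integrable_truncKernel (β i) N).aemeasurable.comp_quasiMeasurePreserving
      (Measure.quasiMeasurePreserving_eval (fun _ : ι => (volume : Measure E)) i)).ennreal_ofReal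
  · filter_upwards [ae_forall_ne_zero] with ξ hξ N M h
    refine mul_le_mul_right (Finset.prod_le_prod' fun i _ => ?_) _
    exact (truncKernel_monotone_and_tendsto (hβ i) (hξ i)).1 h
  · filter_upwards [ae_forall_ne_zero] with ξ hξ
    refine ENNReal.Tendsto.const_mul ?_ (.inr (by finiteness))
    exact ENNReal.tendsto_finsetProd_of_ne_top _ (fun i _ =>
      (truncKernel_monotone_and_tendsto (hβ i) (hξ i)).2)
      fun i _ => rieszKernel_ne_top (norm_pos_iff.2 (hξ i))

theorem tendsto_truncKernelFourier_energy {β : ι → ℝ} (hβ : ∀ i, 0 < β i ∧ β i < dim)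
    {f : E → ℝ≥0∞} (hf : AEMeasurable f) (hft : ∀ x, f x ≠ ∞) :
    Tendsto (fun N => ∫⁻ z : E × E, f z.1 * f z.2 *
      ∏ i, ENNReal.ofReal (truncKernelFourier (β i) N (z.1 - z.2))) atTop
      (𝓝 ((∏ i, ENNReal.ofReal (rieszGamma dim (β i))) *
        rieszEnergy (∑ i, (dim - β i)) f)) := by
  have hne : ∀ᵐ z : E × E, z.1 - z.2 ≠ 0 := by
    rw [Measure.volume_eq_prod, Measure.ae_prod_iff_ae_ae
      (p := fun z : E × E => z.1 - z.2 ≠ 0) (by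
        exact (measurableSet_singleton (0 : E)).compl.preimage (by fun_prop))]
    refine .of_forall fun x => ?_
    filter_upwards [ae_ne x] with y hy h
    exact hy (sub_eq_zero.1 h).symm
  have hK := measurable_rieszKernel_norm (E := E) (∑ i, (dim - β i))
  have hff : AEMeasurable fun z : E × E => f z.1 * f z.2 := by
    rw [Measure.volume_eq_prod]
    exact (hf.comp_quasiMeasurePreserving Measure.quasiMeasurePreserving_fst).mul
      (hf.comp_quasiMeasurePreserving Measure.quasiMeasurePreserving_snd)
  have hE : (∏ i, ENNReal.ofReal (rieszGamma dim (β i))) * rieszEnergy (∑ i, (dim - β i)) f =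
      ∫⁻ z : E × E, f z.1 * f z.2 * ∏ i, (ENNReal.ofReal (rieszGamma dim (β i)) *
        rieszKernel (dim - β i) ‖z.1 - z.2‖) := by
    have hae : (fun z : E × E => f z.1 * f z.2 * ∏ i, (ENNReal.ofReal (rieszGamma dim (β i)) *
        rieszKernel (dim - β i) ‖z.1 - z.2‖)) =ᵐ[volume] fun z =>
        (∏ i, ENNReal.ofReal (rieszGamma dim (β i))) *
          (f z.1 * f z.2 * rieszKernel (∑ i, (dim - β i)) ‖z.1 - z.2‖) := by
      filter_upwards [hne] with z hz
      rw [Finset.prod_mul_distrib, prod_rieszKernel (norm_pos_iff.2 hz)]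
      ring
    have hm : AEMeasurable fun z : E × E =>
        f z.1 * f z.2 * rieszKernel (∑ i, (dim - β i)) ‖z.1 - z.2‖ :=
      hff.mul hK.aemeasurable
    rw [lintegral_congr_ae hae, lintegral_const_mul'' _ hm, Measure.volume_eq_prod,
      lintegral_prod _ hm, rieszEnergy]
    congr 1
    refine lintegral_congr fun x => ?_
    rw [rieszPotential, ← lintegral_const_mul' _ _ (hft x)]
    simp_rw [mul_assoc]
  rw [hE]
  refine lintegral_tendsto_of_tendsto_of_monotone (fun N => ?_) ?_ ?_
  · have hk : ∀ i, Continuous fun v : E => truncKernelFourier (β i) N v := fun i => by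
      have hi : Integrable fun v : E => (truncKernel (β i) N v : ℂ) :=
        (integrable_truncKernel (β i) N).ofReal
      have h2 : (fun v : E => truncKernelFourier (β i) N v) = fun v =>
          (𝓕 (fun v : E => (truncKernel (β i) N v : ℂ)) v).re := by
        ext v
        rw [fourier_truncKernel, Complex.ofReal_re]
      rw [h2]
      exact Complex.continuous_re.comp (continuous_fourier hi)
    exact hff.mul (Finset.measurable_fun_prod _ fun i _ => by
      have := (hk i).measurable
      fun_prop).aemeasurable
  · filter_upwards [hne] with z hz N M h
    refine mul_le_mul_right (Finset.prod_le_prod' fun i _ => ?_) _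
    exact (truncKernelFourier_monotone_and_tendsto (hβ i).1 (hβ i).2 hz).1 h
  · filter_upwards [hne] with z hz
    refine ENNReal.Tendsto.const_mul ?_ (.inr (ENNReal.mul_ne_top (hft _) (hft _)))
    exact ENNReal.tendsto_finsetProd_of_ne_top _ (fun i _ =>
      (truncKernelFourier_monotone_and_tendsto (hβ i).1 (hβ i).2 hz).2)
      fun i _ => ENNReal.mul_ne_top ENNReal.ofReal_ne_top
        (rieszKernel_ne_top (norm_pos_iff.2 hz))

theorem fourierEnergy_le {β : ι → ℝ} (hβ : ∀ i, 0 < β i ∧ β i < dim) {g : E → ℂ}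
    (hg : Integrable g) :
    fourierEnergy β g ≤ (∏ i, ENNReal.ofReal (rieszGamma dim (β i))) *
      rieszEnergy (∑ i, (dim - β i)) (fun x => ‖g x‖ₑ) := by
  refine le_of_tendsto_of_tendsto' (tendsto_fourierEnergy (fun i => (hβ i).1) hg)
    (tendsto_truncKernelFourier_energy hβ hg.aestronglyMeasurable.enorm fun x => enorm_ne_top)
    fun N => ?_
  rw [lintegral_norm_sq_fourier_mul_truncKernel (fun i => (hβ i).1) hg]
  refine (enorm_integral_le_lintegral_enorm _).trans_eq (lintegral_congr fun z => ?_)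
  have h0 : ∀ i ∈ Finset.univ, 0 ≤ truncKernelFourier (β i) N (z.1 - z.2) :=
    fun i _ => truncKernelFourier_nonneg (hβ i).1 N _
  rw [enorm_mul, enorm_mul, ← ENNReal.ofReal_prod_of_nonneg h0, RCLike.enorm_conj,
    ← ofReal_norm (Complex.ofReal _), Complex.norm_real,
    Real.norm_of_nonneg (Finset.prod_nonneg h0)]

theorem fourierEnergy_ofReal {β : ι → ℝ} (hβ : ∀ i, 0 < β i ∧ β i < dim) {h : E → ℝ}
    (h0 : ∀ x, 0 ≤ h x) (hh : Integrable h) :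
    fourierEnergy β (fun x => (h x : ℂ)) = (∏ i, ENNReal.ofReal (rieszGamma dim (β i))) *
      rieszEnergy (∑ i, (dim - β i)) (fun x => ENNReal.ofReal (h x)) := by
  have hhc : Integrable fun x => (h x : ℂ) := hh.ofReal
  refine tendsto_nhds_unique (tendsto_fourierEnergy (fun i => (hβ i).1) hhc) ?_
  convert tendsto_truncKernelFourier_energy hβ hh.aemeasurable.ennreal_ofReal
    fun x => ENNReal.ofReal_ne_top using 2 with N
  have hk : ∀ i, Integrable fun v : E => (truncKernel (β i) N v : ℂ) := fun i =>
    (integrable_truncKernel (β i) N).ofReal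
  have hint := integrable_mul_conj_mul_prod_fourier hhc hk
  rw [lintegral_norm_sq_fourier_mul_truncKernel (fun i => (hβ i).1) hhc]
  have hP : ∀ z : E × E, 0 ≤ ∏ i, truncKernelFourier (β i) N (z.1 - z.2) := fun z =>
    Finset.prod_nonneg fun i _ => truncKernelFourier_nonneg (hβ i).1 N _
  have hz0 : ∀ z : E × E, 0 ≤ h z.1 * h z.2 * ∏ i, truncKernelFourier (β i) N (z.1 - z.2) :=
    fun z => mul_nonneg (mul_nonneg (h0 _) (h0 _)) (hP z)
  simp_rw [fourier_truncKernel, ← Complex.ofReal_prod] at hint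
  simp only [Complex.conj_ofReal, ← Complex.ofReal_mul] at hint ⊢
  rw [integral_complex_ofReal, ← ofReal_norm, Complex.norm_real,
    Real.norm_of_nonneg (integral_nonneg hz0),
    ofReal_integral_eq_lintegral_ofReal (by exact hint.re) (.of_forall hz0)]
  refine lintegral_congr fun z => ?_
  rw [ENNReal.ofReal_mul (mul_nonneg (h0 _) (h0 _)), ENNReal.ofReal_mul (h0 _),
    ENNReal.ofReal_prod_of_nonneg fun i _ => truncKernelFourier_nonneg (hβ i).1 N _]

end EnergyIdentity

section FourierInversion

open scoped FourierTransform SchwartzMap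

variable {m n : ℕ}

theorem volume_preserving_uncurry (ι κ : Type*) [Fintype ι] [Fintype κ] :
    MeasurePreserving (MeasurableEquiv.curry ι κ ℝ).symm := by
  refine ⟨(MeasurableEquiv.curry ι κ ℝ).symm.measurable, ?_⟩
  refine (Measure.pi_eq fun s hs => ?_).symm
  rw [MeasurableEquiv.map_apply]
  have : (MeasurableEquiv.curry ι κ ℝ).symm ⁻¹' Set.univ.pi s =
      Set.univ.pi fun i => Set.univ.pi fun j => s (i, j) := by
    ext x
    simp [MeasurableEquiv.curry, Function.uncurry, Set.mem_pi]
  rw [this, volume_pi_pi, Fintype.prod_prod_type]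
  simp_rw [volume_pi_pi]

/-- The splitting of `ℝ^{mn}` into `m` blocks of length `n`. -/
def blockEquiv (m n : ℕ) :
    EuclideanSpace ℝ (Fin m × Fin n) ≃L[ℝ] (Fin m → EuclideanSpace ℝ (Fin n)) :=
  LinearEquiv.toContinuousLinearEquiv
    { toFun := fun w k => WithLp.toLp 2 fun j => w (k, j)
      invFun := fun x => WithLp.toLp 2 fun p => x p.1 p.2
      map_add' := fun _ _ => rfl
      map_smul' := fun _ _ => rfl
      left_inv := fun _ => rfl
      right_inv := fun _ => rfl }

theorem volume_preserving_blockEquiv : MeasurePreserving (blockEquiv m n) := by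
  have h1 := PiLp.volume_preserving_ofLp (Fin m × Fin n)
  have h2 := (volume_preserving_uncurry (Fin m) (Fin n)).symm
  have h3 := volume_preserving_pi (fun _ : Fin m => PiLp.volume_preserving_toLp (Fin n))
  exact h3.comp (h2.comp h1)

theorem inner_blockEquiv (v w : EuclideanSpace ℝ (Fin m × Fin n)) :
    ∑ k, ⟪blockEquiv m n v k, blockEquiv m n w k⟫_ℝ = ⟪v, w⟫_ℝ := by
  simp only [PiLp.inner_apply, Fintype.sum_prod_type]
  rfl

theorem integral_blockEquiv (f : (Fin m → EuclideanSpace ℝ (Fin n)) → ℂ) :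
    ∫ x, f x = ∫ v, f (blockEquiv m n v) :=
  (volume_preserving_blockEquiv.integral_comp
    (blockEquiv m n).toHomeomorph.measurableEmbedding f).symm

theorem fourierM_blockEquiv (f : (Fin m → EuclideanSpace ℝ (Fin n)) → ℂ)
    (w : EuclideanSpace ℝ (Fin m × Fin n)) :
    fourierM f (blockEquiv m n w) = 𝓕⁻ (fun v => f (blockEquiv m n v)) w := by
  rw [fourierM, integral_blockEquiv, Real.fourierInv_eq']
  refine integral_congr_ae (.of_forall fun v => ?_)
  beta_reduce
  rw [inner_blockEquiv, smul_eq_mul]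
  push_cast
  ring_nf

/-- Pull back a Schwartz function along `blockEquiv`. -/
def schwartzBlock : 𝓢(Fin m → EuclideanSpace ℝ (Fin n), ℂ) →L[ℂ]
    𝓢(EuclideanSpace ℝ (Fin m × Fin n), ℂ) :=
  SchwartzMap.compCLMOfContinuousLinearEquiv ℂ (blockEquiv m n)

theorem fourierM_eq (f : 𝓢(Fin m → EuclideanSpace ℝ (Fin n), ℂ)) :
    fourierM f = fun ξ => (𝓕⁻ (schwartzBlock f)) ((blockEquiv m n).symm ξ) := by
  ext ξ
  obtain ⟨w, rfl⟩ := (blockEquiv m n).surjective ξ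
  rw [fourierM_blockEquiv, ContinuousLinearEquiv.symm_apply_apply, SchwartzMap.fourierInv_coe]
  rfl

theorem exists_fourierM_eq (φ : 𝓢(Fin m → EuclideanSpace ℝ (Fin n), ℂ)) :
    ∃ f : 𝓢(Fin m → EuclideanSpace ℝ (Fin n), ℂ), fourierM f = φ := by
  refine ⟨SchwartzMap.compCLMOfContinuousLinearEquiv ℂ (blockEquiv m n).symm
    (𝓕 (schwartzBlock φ)), ?_⟩
  rw [fourierM_eq]
  have : schwartzBlock (SchwartzMap.compCLMOfContinuousLinearEquiv ℂ (blockEquiv m n).symm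
      (𝓕 (schwartzBlock φ))) = 𝓕 (schwartzBlock φ) := by
    ext v
    simp [schwartzBlock]
  rw [this, FourierTransform.fourierInv_fourier_eq]
  ext ξ
  simp [schwartzBlock]

theorem exists_schwartz_eq_fourierM (f : 𝓢(Fin m → EuclideanSpace ℝ (Fin n), ℂ)) :
    ∃ φ : 𝓢(Fin m → EuclideanSpace ℝ (Fin n), ℂ), fourierM f = φ := by
  refine ⟨SchwartzMap.compCLMOfContinuousLinearEquiv ℂ (blockEquiv m n).symm
    (𝓕⁻ (schwartzBlock f)), ?_⟩
  rw [fourierM_eq]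
  rfl

theorem schwartz_eq_integral_fourierM (f : 𝓢(Fin m → EuclideanSpace ℝ (Fin n), ℂ))
    (x : Fin m → EuclideanSpace ℝ (Fin n)) :
    f x = ∫ ξ, fourierPhase (∑ k, ⟪ξ k, x k⟫_ℝ) * fourierM f ξ := by
  obtain ⟨w, rfl⟩ := (blockEquiv m n).surjective x
  rw [integral_blockEquiv]
  simp_rw [inner_blockEquiv, fourierM_eq, ContinuousLinearEquiv.symm_apply_apply]
  rw [← fourier_eq_integral_fourierPhase, ← SchwartzMap.fourier_coe,
    FourierTransform.fourier_fourierInv_eq]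
  rfl

end FourierInversion

section Duality

open scoped FourierTransform SchwartzMap ComplexConjugate

variable {m n : ℕ}

theorem hasTemperateGrowth_volume_pi :
    (volume : Measure (Fin m → EuclideanSpace ℝ (Fin n))).HasTemperateGrowth := by
  have : (volume : Measure (Fin m → EuclideanSpace ℝ (Fin n))).IsAddHaarMeasure :=
    Measure.pi.isAddHaarMeasure _
  infer_instance

theorem integral_diagonal_mul (f : 𝓢(Fin m → EuclideanSpace ℝ (Fin n), ℂ))
    {g : EuclideanSpace ℝ (Fin n) → ℂ} (hg : Integrable g) :
    ∫ x, f (fun _ => x) * g x = ∫ ξ, fourierM f ξ * 𝓕 g (∑ k, ξ k) := by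
  obtain ⟨φ, hφ⟩ := exists_schwartz_eq_fourierM f
  have := hasTemperateGrowth_volume_pi (m := m) (n := n)
  have hint : Integrable (Function.uncurry
      fun (x : EuclideanSpace ℝ (Fin n)) (ξ : Fin m → EuclideanSpace ℝ (Fin n)) =>
        fourierPhase (∑ k, ⟪ξ k, x⟫_ℝ) * (g x * φ ξ)) := by
    refine (hg.mul_prod φ.integrable).bdd_mul (c := 1) ?_ (.of_forall fun z => ?_)
    · have := continuous_fourierPhase
      exact Continuous.aestronglyMeasurable (by fun_prop)
    · exact (norm_fourierPhase _).le
  calc ∫ x, f (fun _ => x) * g x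
      = ∫ x, ∫ ξ : Fin m → EuclideanSpace ℝ (Fin n),
          fourierPhase (∑ k, ⟪ξ k, x⟫_ℝ) * (g x * φ ξ) := by
        refine integral_congr_ae (.of_forall fun x => ?_)
        beta_reduce
        rw [schwartz_eq_integral_fourierM f, ← integral_mul_const, hφ]
        refine integral_congr_ae (.of_forall fun ξ => ?_)
        beta_reduce
        ring
    _ = ∫ ξ : Fin m → EuclideanSpace ℝ (Fin n), ∫ x,
          fourierPhase (∑ k, ⟪ξ k, x⟫_ℝ) * (g x * φ ξ) := integral_integral_swap hint
    _ = ∫ ξ, fourierM f ξ * 𝓕 g (∑ k, ξ k) := by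
        refine integral_congr_ae (.of_forall fun ξ => ?_)
        beta_reduce
        rw [fourier_eq_integral_fourierPhase, ← integral_const_mul, hφ]
        refine integral_congr_ae (.of_forall fun x => ?_)
        beta_reduce
        rw [inner_sum]
        simp_rw [real_inner_comm x]
        ring

theorem sq_lintegral_mul_le {X : Type*} [MeasurableSpace X] {μ : Measure X} {w a b : X → ℝ≥0∞}
    (hw : Measurable w) (ha : Measurable a) (hb : Measurable b)
    (h0 : ∀ᵐ x ∂μ, w x ≠ 0) (ht : ∀ᵐ x ∂μ, w x ≠ ∞) :
    (∫⁻ x, a x * b x ∂μ) ^ 2 ≤ (∫⁻ x, w x * a x ^ 2 ∂μ) * ∫⁻ x, b x ^ 2 * (w x)⁻¹ ∂μ := by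
  have h := ENNReal.lintegral_mul_le_Lp_mul_Lq μ Real.HolderConjugate.two_two
    (f := fun x => w x ^ (2⁻¹ : ℝ) * a x) (g := fun x => (w x)⁻¹ ^ (2⁻¹ : ℝ) * b x)
    (by fun_prop) (by fun_prop)
  have e1 : ∫⁻ x, a x * b x ∂μ = ∫⁻ x, ((fun x => w x ^ (2⁻¹ : ℝ) * a x) *
      fun x => (w x)⁻¹ ^ (2⁻¹ : ℝ) * b x) x ∂μ := by
    refine lintegral_congr_ae ?_
    filter_upwards [h0, ht] with x hx0 hxt
    have : w x ^ (2⁻¹ : ℝ) * (w x)⁻¹ ^ (2⁻¹ : ℝ) = 1 := by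
      rw [← ENNReal.mul_rpow_of_nonneg _ _ (by norm_num), ENNReal.mul_inv_cancel hx0 hxt,
        ENNReal.one_rpow]
    rw [Pi.mul_apply, mul_mul_mul_comm, this, one_mul]
  have hs : ∀ c d : ℝ≥0∞, (c ^ (2⁻¹ : ℝ) * d) ^ (2 : ℝ) = c * d ^ 2 := fun c d => by
    rw [ENNReal.mul_rpow_of_nonneg _ _ (by norm_num), ← ENNReal.rpow_mul]
    norm_num
  rw [← e1] at h
  simp_rw [hs] at h
  calc (∫⁻ x, a x * b x ∂μ) ^ 2 ≤ _ := pow_le_pow_left' h 2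
    _ = _ := by
      rw [mul_pow, ← ENNReal.rpow_natCast, ← ENNReal.rpow_natCast, ← ENNReal.rpow_mul,
        ← ENNReal.rpow_mul]
      norm_num
      simp_rw [mul_comm]

theorem enorm_integral_diagonal_mul_sq_le (f : 𝓢(Fin m → EuclideanSpace ℝ (Fin n), ℂ))
    [Nontrivial (EuclideanSpace ℝ (Fin n))] {α : Fin m → ℝ}
    {g : EuclideanSpace ℝ (Fin n) → ℂ} (hg : Integrable g) :
    ‖∫ x, f (fun _ => x) * g x‖ₑ ^ 2 ≤ LamM f α * fourierEnergy α g := by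
  have hc : Continuous (𝓕 g) := continuous_fourier hg
  obtain ⟨φ, hφ⟩ := exists_schwartz_eq_fourierM f
  have hφc : Continuous φ := φ.continuous
  rw [integral_diagonal_mul f hg]
  calc ‖∫ ξ, fourierM f ξ * 𝓕 g (∑ k, ξ k)‖ₑ ^ 2
      ≤ (∫⁻ ξ, ‖fourierM f ξ‖ₑ * ‖𝓕 g (∑ k, ξ k)‖ₑ) ^ 2 := by
        refine pow_le_pow_left' ((enorm_integral_le_lintegral_enorm _).trans_eq ?_) 2
        simp_rw [enorm_mul]
    _ ≤ _ := sq_lintegral_mul_le (w := fun ξ => ∏ k, ENNReal.ofReal (‖ξ k‖ ^ α k))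
        (by fun_prop) (by rw [hφ]; fun_prop)
        (hc.comp (by fun_prop)).enorm.measurable ?_ ?_
    _ = _ := ?_
  · filter_upwards [ae_forall_ne_zero] with ξ hξ
    refine Finset.prod_ne_zero_iff.2 fun k _ => ?_
    have := norm_pos_iff.2 (hξ k)
    simpa using Real.rpow_pos_of_pos this _
  · exact .of_forall fun ξ => ENNReal.prod_ne_top fun k _ => ENNReal.ofReal_ne_top
  · rw [LamM, fourierEnergy]
    congr 1
    refine lintegral_congr_ae ?_
    filter_upwards [ae_forall_ne_zero] with ξ hξ
    congr 1
    rw [ENNReal.prod_inv_distrib]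
    · rfl
    · intro i _ j _ _
      exact Or.inr ENNReal.ofReal_ne_top

end Duality

section UpperBound

open scoped FourierTransform SchwartzMap ComplexConjugate

theorem enorm_rpow_sub_two_mul_conj {q : ℝ} (hq : 2 < q) (z : ℂ) :
    ‖((‖z‖ ^ (q - 2) : ℝ) : ℂ) * conj z‖ₑ = ‖z‖ₑ ^ (q - 1) := by
  rw [enorm_mul, RCLike.enorm_conj, ← ofReal_norm (((‖z‖ ^ (q - 2) : ℝ) : ℂ)), Complex.norm_real,
    Real.norm_of_nonneg (by positivity), ← ENNReal.ofReal_rpow_of_nonneg (norm_nonneg _)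
    (by linarith), ofReal_norm, show q - 1 = q - 2 + 1 by ring,
    ENNReal.rpow_add_of_nonneg _ _ (by linarith) zero_le_one, ENNReal.rpow_one]

theorem mul_rpow_sub_two_mul_conj {q : ℝ} (hq : 2 < q) (z : ℂ) :
    z * (((‖z‖ ^ (q - 2) : ℝ) : ℂ) * conj z) = ((‖z‖ ^ q : ℝ) : ℂ) := by
  rw [mul_left_comm, Complex.mul_conj, Complex.normSq_eq_norm_sq, ← Complex.ofReal_mul,
    ← Real.rpow_natCast, ← Real.rpow_add_of_nonneg (norm_nonneg _) (by linarith) (by norm_num)]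
  norm_num

variable {m n : ℕ}

/-- The diagonal trace of a Schwartz function. -/
def diagonalTrace (hm : 1 ≤ m) :
    𝓢(Fin m → EuclideanSpace ℝ (Fin n), ℂ) →L[ℂ] 𝓢(EuclideanSpace ℝ (Fin n), ℂ) :=
  SchwartzMap.compCLMOfAntilipschitz ℂ (K := 1)
    (g := (ContinuousLinearMap.pi fun _ : Fin m =>
      ContinuousLinearMap.id ℝ (EuclideanSpace ℝ (Fin n))))
    (ContinuousLinearMap.hasTemperateGrowth _) (by
      have : Nonempty (Fin m) := ⟨⟨0, hm⟩⟩
      refine AntilipschitzWith.of_le_mul_dist fun x y => ?_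
      simp)

theorem lintegral_enorm_schwartz_rpow_lt_top (u : 𝓢(EuclideanSpace ℝ (Fin n), ℂ)) {p : ℝ}
    (hp : 0 < p) : ∫⁻ x, ‖u x‖ₑ ^ p < ∞ := by
  have := lintegral_rpow_enorm_lt_top_of_eLpNorm_lt_top (p := ENNReal.ofReal p) (f := u)
    (μ := volume) (by simpa using hp) ENNReal.ofReal_ne_top (u.memLp _ _).2
  rwa [ENNReal.toReal_ofReal hp.le] at this

theorem lintegral_diagonal_rpow_le (hm : 1 ≤ m) (hn : 1 ≤ n) {α : Fin m → ℝ}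
    (hα : ∀ k, 0 < α k ∧ α k < n) {l : ℝ} (hl : l = ∑ k, ((n : ℝ) - α k)) (hl0 : 0 < l)
    (hln : l < n) (f : 𝓢(Fin m → EuclideanSpace ℝ (Fin n), ℂ)) :
    (∫⁻ x : EuclideanSpace ℝ (Fin n), ‖f fun _ => x‖ₑ ^ (2 * n / l)) ^ (l / n) ≤
      (∏ k, ENNReal.ofReal (rieszGamma n (α k))) * hlsConst (EuclideanSpace ℝ (Fin n)) l *
        LamM f α := by
  have : Nonempty (Fin n) := ⟨⟨0, hn⟩⟩
  have hn0 : (0 : ℝ) < n := by positivity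
  have hdim : Module.finrank ℝ (EuclideanSpace ℝ (Fin n)) = n := finrank_euclideanSpace_fin
  set q : ℝ := 2 * n / l with hq
  have hql : q * l = 2 * n := by rw [hq]; field_simp
  have hq2 : 2 < q := by rw [hq, lt_div_iff₀ hl0]; linarith
  set u := diagonalTrace hm f with hu
  have huc : Continuous u := u.continuous
  set N := ∫⁻ x, ‖u x‖ₑ ^ q with hN
  change N ^ (l / n) ≤ _
  have hNt : N ≠ ∞ := (lintegral_enorm_schwartz_rpow_lt_top u (by linarith)).ne
  set g : EuclideanSpace ℝ (Fin n) → ℂ := fun x => ((‖u x‖ ^ (q - 2) : ℝ) : ℂ) * conj (u x)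
    with hg
  have hge : ∀ x, ‖g x‖ₑ = ‖u x‖ₑ ^ (q - 1) := fun x => enorm_rpow_sub_two_mul_conj hq2 _
  have hgm : Measurable g := by
    have : Measurable fun x => conj (u x) := Complex.continuous_conj.measurable.comp huc.measurable
    fun_prop
  have hgi : Integrable g := by
    refine ⟨hgm.aestronglyMeasurable, ?_⟩
    rw [HasFiniteIntegral]
    simp_rw [hge]
    exact lintegral_enorm_schwartz_rpow_lt_top u (by linarith)
  have hpair : ‖∫ x, f (fun _ => x) * g x‖ₑ = N := by
    have : ∀ x, f (fun _ => x) * g x = ((‖u x‖ ^ q : ℝ) : ℂ) := fun x =>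
      mul_rpow_sub_two_mul_conj hq2 (u x)
    simp_rw [this]
    have hnn : ∀ x, 0 ≤ ‖u x‖ ^ q := fun x => by positivity
    have he : ∀ x, ENNReal.ofReal (‖u x‖ ^ q) = ‖u x‖ₑ ^ q := fun x => by
      rw [← ENNReal.ofReal_rpow_of_nonneg (norm_nonneg _) (by linarith), ofReal_norm]
    have hui : Integrable fun x => ‖u x‖ ^ q := by
      refine (lintegral_ofReal_ne_top_iff_integrable
        (Measurable.aestronglyMeasurable (by fun_prop)) (.of_forall hnn)).1 ?_
      simp_rw [he]
      exact hNt
    rw [integral_complex_ofReal, ← ofReal_norm, Complex.norm_real,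
      Real.norm_of_nonneg (integral_nonneg hnn),
      ofReal_integral_eq_lintegral_ofReal hui (.of_forall hnn)]
    simp_rw [he, hN]
  have hmain := enorm_integral_diagonal_mul_sq_le f (α := α) hgi
  rw [hpair] at hmain
  have hE := fourierEnergy_le (E := EuclideanSpace ℝ (Fin n)) (β := α) (by rwa [hdim]) hgi
  have hhls := rieszEnergy_le_hlsConst (E := EuclideanSpace ℝ (Fin n)) (l := l) hl0
    (by rw [hdim]; linarith)
    (by rw [rieszPotential_bubble_zero hl0 (by rwa [hdim])]; exact ENNReal.ofReal_ne_top)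
    (by rw [lintegral_bubble_two_mul_dim]; exact ENNReal.ofReal_ne_top)
    (f := fun x => ‖g x‖ₑ) (by fun_prop)
  rw [hdim] at hE hhls
  rw [← hl] at hE
  have hexp : (q - 1) * (2 * n / (2 * n - l)) = q := by
    have : 2 * (n : ℝ) - l ≠ 0 := by linarith
    rw [hq]
    field_simp
  simp_rw [hge, ← ENNReal.rpow_mul, hexp] at hhls
  rw [← hN] at hhls
  simp_rw [hge] at hE
  rcases eq_or_ne N 0 with h0 | h0
  · rw [h0, ENNReal.zero_rpow_of_pos (by positivity)]
    exact zero_le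
  have hsplit : N ^ 2 = N ^ (l / n) * N ^ ((2 * n - l) / n) := by
    rw [← ENNReal.rpow_add _ _ h0 hNt, ← ENNReal.rpow_natCast]
    congr 1
    push_cast
    field_simp
    ring
  have hP0 : N ^ ((2 * n - l) / n) ≠ 0 := (ENNReal.rpow_pos (pos_iff_ne_zero.2 h0) hNt).ne'
  have hPt : N ^ ((2 * n - l) / n) ≠ ∞ :=
    ENNReal.rpow_ne_top_of_nonneg (div_nonneg (by linarith) hn0.le) hNt
  rw [← ENNReal.mul_le_mul_iff_left hP0 hPt, ← hsplit]
  calc N ^ 2 ≤ LamM f α * ((∏ k, ENNReal.ofReal (rieszGamma n (α k))) *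
        (hlsConst (EuclideanSpace ℝ (Fin n)) l * N ^ ((2 * n - l) / n))) :=
        hmain.trans (by gcongr; exact hE.trans (by gcongr))
    _ = _ := by ring

end UpperBound

section LowerBound

open scoped FourierTransform SchwartzMap ComplexConjugate

variable {m n : ℕ}

theorem eLpNorm_two_sq {X : Type*} [MeasurableSpace X] (μ : Measure X) (f : X → ℂ) :
    eLpNorm f 2 μ ^ 2 = ∫⁻ x, ‖f x‖ₑ ^ 2 ∂μ := by
  have h := eLpNorm_nnreal_pow_eq_lintegral (μ := μ) (f := f) (p := 2) two_ne_zero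
  simpa using h

/-- The weight `∏ |ξ_k|^{α_k}`. -/
def weight (α : Fin m → ℝ) (ξ : Fin m → EuclideanSpace ℝ (Fin n)) : ℝ := ∏ k, ‖ξ k‖ ^ α k

theorem weight_nonneg (α : Fin m → ℝ) (ξ : Fin m → EuclideanSpace ℝ (Fin n)) :
    0 ≤ weight α ξ := Finset.prod_nonneg fun _ _ => by positivity

theorem ofReal_weight (α : Fin m → ℝ) (ξ : Fin m → EuclideanSpace ℝ (Fin n)) :
    ENNReal.ofReal (weight α ξ) = ∏ k, ENNReal.ofReal (‖ξ k‖ ^ α k) :=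
  ENNReal.ofReal_prod_of_nonneg fun _ _ => by positivity

theorem inv_ofReal_weight (α : Fin m → ℝ) (ξ : Fin m → EuclideanSpace ℝ (Fin n)) :
    (ENNReal.ofReal (weight α ξ))⁻¹ = ∏ k, rieszKernel (α k) ‖ξ k‖ := by
  rw [ofReal_weight, ENNReal.prod_inv_distrib fun i _ j _ _ => .inr ENNReal.ofReal_ne_top]
  rfl

theorem continuous_weight {α : Fin m → ℝ} (hα : ∀ k, 0 < α k) :
    Continuous (weight α : (Fin m → EuclideanSpace ℝ (Fin n)) → ℝ) :=
  continuous_finsetProd _ fun k _ =>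
    (continuous_norm.comp (continuous_apply k)).rpow_const fun _ => .inr (hα k).le

theorem ae_weight_pos [Nontrivial (EuclideanSpace ℝ (Fin n))] (α : Fin m → ℝ) :
    ∀ᵐ ξ : Fin m → EuclideanSpace ℝ (Fin n), 0 < weight α ξ := by
  filter_upwards [ae_forall_ne_zero] with ξ hξ
  exact Finset.prod_pos fun k _ => Real.rpow_pos_of_pos (norm_pos_iff.2 (hξ k)) _

theorem weight_le {α : Fin m → ℝ} (hα : ∀ k, 0 < α k) (ξ : Fin m → EuclideanSpace ℝ (Fin n)) :
    weight α ξ ≤ (1 + ‖ξ‖) ^ (∑ k, α k) := by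
  rw [Real.rpow_sum_of_pos (by positivity)]
  refine Finset.prod_le_prod (fun k _ => by positivity) fun k _ => ?_
  exact Real.rpow_le_rpow (norm_nonneg _) (by linarith [norm_le_pi_norm ξ k]) (hα k).le

/-- The measure `∏ |ξ_k|^{α_k} dξ`. -/
def weightedMeasure (n : ℕ) (α : Fin m → ℝ) : Measure (Fin m → EuclideanSpace ℝ (Fin n)) :=
  volume.withDensity fun ξ => ENNReal.ofReal (weight α ξ)

theorem isLocallyFiniteMeasure_weightedMeasure {α : Fin m → ℝ} (hα : ∀ k, 0 < α k) :
    IsLocallyFiniteMeasure (weightedMeasure n α) :=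
  IsLocallyFiniteMeasure.withDensity_ofReal (continuous_weight hα)

theorem hasTemperateGrowth_weightedMeasure {α : Fin m → ℝ} (hα : ∀ k, 0 < α k) :
    (weightedMeasure n α).HasTemperateGrowth := by
  have hW : Continuous (weight α : (Fin m → EuclideanSpace ℝ (Fin n)) → ℝ) := continuous_weight hα
  have : (volume : Measure (Fin m → EuclideanSpace ℝ (Fin n))).IsAddHaarMeasure :=
    Measure.pi.isAddHaarMeasure _
  set r : ℝ := Module.finrank ℝ (Fin m → EuclideanSpace ℝ (Fin n)) + 1 with hr
  obtain ⟨N, hN⟩ := exists_nat_ge (∑ k, α k + r)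
  refine ⟨⟨N, ?_⟩⟩
  rw [weightedMeasure, integrable_withDensity_iff (by fun_prop) (by simp)]
  refine (integrable_one_add_norm (μ := volume) (r := r) (by linarith)).mono'
    (Measurable.aestronglyMeasurable (by fun_prop)) (.of_forall fun ξ => ?_)
  rw [ENNReal.toReal_ofReal (weight_nonneg α ξ),
    Real.norm_of_nonneg (mul_nonneg (by positivity) (weight_nonneg α ξ))]
  calc (1 + ‖ξ‖) ^ (-(N : ℝ)) * weight α ξ
      ≤ (1 + ‖ξ‖) ^ (-(N : ℝ)) * (1 + ‖ξ‖) ^ (∑ k, α k) := by gcongr; exact weight_le hα ξ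
    _ = (1 + ‖ξ‖) ^ (-(N : ℝ) + ∑ k, α k) := (Real.rpow_add (by positivity) _ _).symm
    _ ≤ (1 + ‖ξ‖) ^ (-r) :=
      Real.rpow_le_rpow_of_exponent_le (by linarith [norm_nonneg ξ]) (by linarith)

theorem lintegral_weightedMeasure {α : Fin m → ℝ} (hα : ∀ k, 0 < α k)
    {a : (Fin m → EuclideanSpace ℝ (Fin n)) → ℝ≥0∞} (ha : Measurable a) :
    ∫⁻ ξ, a ξ ∂weightedMeasure n α = ∫⁻ ξ, ENNReal.ofReal (weight α ξ) * a ξ := by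
  have hW := continuous_weight (n := n) hα
  exact lintegral_withDensity_eq_lintegral_mul _ (by fun_prop) ha

theorem integral_weightedMeasure {α : Fin m → ℝ} (hα : ∀ k, 0 < α k)
    (a : (Fin m → EuclideanSpace ℝ (Fin n)) → ℂ) :
    ∫ ξ, a ξ ∂weightedMeasure n α = ∫ ξ, (weight α ξ : ℂ) * a ξ := by
  have hW := continuous_weight (n := n) hα
  rw [weightedMeasure, integral_withDensity_eq_integral_toReal_smul (by fun_prop) (by simp)]
  simp_rw [ENNReal.toReal_ofReal (weight_nonneg α _), Complex.real_smul]

/-- If the trace functional `f ↦ ∫ f(x,…,x) g(x) dx` is bounded for the weighted form, its squared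
norm is at least the weighted Fourier energy of `g`. -/
theorem fourierEnergy_le_of_forall [Nontrivial (EuclideanSpace ℝ (Fin n))] {α : Fin m → ℝ}
    (hα : ∀ k, 0 < α k) {g : EuclideanSpace ℝ (Fin n) → ℂ} (hg : Integrable g)
    (hfin : fourierEnergy α g ≠ ∞) {c : ℝ≥0∞} (hc : c ≠ ∞)
    (h : ∀ f : 𝓢(Fin m → EuclideanSpace ℝ (Fin n), ℂ),
      ‖∫ x, f (fun _ => x) * g x‖ₑ ^ 2 ≤ c * LamM f α) :
    fourierEnergy α g ≤ c := by
  have hW := continuous_weight (n := n) hα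
  have hgc : Continuous (𝓕 g) := continuous_fourier hg
  have := isLocallyFiniteMeasure_weightedMeasure (n := n) hα
  have := hasTemperateGrowth_weightedMeasure (n := n) hα
  set μ := weightedMeasure n α with hμ
  set Φ : (Fin m → EuclideanSpace ℝ (Fin n)) → ℂ :=
    fun ξ => conj (𝓕 g (∑ k, ξ k)) * ((weight α ξ)⁻¹ : ℝ) with hΦ
  have hΦm : Measurable Φ := by
    have h1 : Continuous fun ξ : Fin m → EuclideanSpace ℝ (Fin n) => conj (𝓕 g (∑ k, ξ k)) :=
      Complex.continuous_conj.comp (hgc.comp (by fun_prop))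
    fun_prop
  have hΦsq : ∫⁻ ξ, ‖Φ ξ‖ₑ ^ 2 ∂μ = fourierEnergy α g := by
    rw [hμ, lintegral_weightedMeasure hα (by fun_prop), fourierEnergy]
    refine lintegral_congr_ae ?_
    filter_upwards [ae_weight_pos α] with ξ hξ
    have h1 : ‖(((weight α ξ)⁻¹ : ℝ) : ℂ)‖ₑ = (ENNReal.ofReal (weight α ξ))⁻¹ := by
      rw [← ofReal_norm, Complex.norm_real, Real.norm_of_nonneg (inv_nonneg.2 hξ.le),
        ENNReal.ofReal_inv_of_pos hξ]
    rw [← inv_ofReal_weight, hΦ]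
    beta_reduce
    rw [enorm_mul, RCLike.enorm_conj, h1, mul_pow, sq (ENNReal.ofReal (weight α ξ))⁻¹,
      mul_left_comm, ← mul_assoc (ENNReal.ofReal _),
      ENNReal.mul_inv_cancel (ENNReal.ofReal_pos.2 hξ).ne' ENNReal.ofReal_ne_top, one_mul]
  have hΦL : MemLp Φ 2 μ := by
    refine ⟨hΦm.aestronglyMeasurable, ?_⟩
    have : eLpNorm Φ 2 μ ^ 2 < ∞ := by rw [eLpNorm_two_sq, hΦsq]; exact hfin.lt_top
    simpa using this
  have hΦe : ‖hΦL.toLp Φ‖ₑ ^ 2 = fourierEnergy α g := by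
    rw [Lp.enorm_toLp, eLpNorm_two_sq, hΦsq]
  have key : ∀ ψ : Lp ℂ 2 μ, ‖inner ℂ (hΦL.toLp Φ) ψ‖ₑ ^ 2 ≤ c * ‖ψ‖ₑ ^ 2 := by
    intro ψ
    refine (SchwartzMap.denseRange_toLpCLM (E := Fin m → EuclideanSpace ℝ (Fin n)) (F := ℂ)
      (p := 2) (by simp) (μ := μ)).induction_on
      (p := fun ψ => ‖inner ℂ (hΦL.toLp Φ) ψ‖ₑ ^ 2 ≤ c * ‖ψ‖ₑ ^ 2) ψ ?_ fun φ => ?_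
    · refine isClosed_le ?_ ?_
      · fun_prop
      · exact (ENNReal.continuous_const_mul hc).comp (by fun_prop)
    · obtain ⟨f, hf⟩ := exists_fourierM_eq φ
      have hφm : Continuous φ := φ.continuous
      have h1 : inner ℂ (hΦL.toLp Φ) (φ.toLp 2 μ) = ∫ x, f (fun _ => x) * g x := by
        rw [integral_diagonal_mul f hg, L2.inner_def]
        calc ∫ ξ, inner ℂ (hΦL.toLp Φ ξ) (φ.toLp 2 μ ξ) ∂μ
            = ∫ ξ, φ ξ * conj (Φ ξ) ∂μ := by
              refine integral_congr_ae ?_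
              filter_upwards [hΦL.coeFn_toLp, φ.coeFn_toLp 2 μ] with ξ h2 h3
              rw [h2, h3, RCLike.inner_apply]
          _ = ∫ ξ, (weight α ξ : ℂ) * (φ ξ * conj (Φ ξ)) := integral_weightedMeasure hα _
          _ = _ := by
              refine integral_congr_ae ?_
              filter_upwards [ae_weight_pos α] with ξ hξ
              have : (weight α ξ : ℂ) ≠ 0 := by exact_mod_cast hξ.ne'
              rw [hf, hΦ]
              simp only [map_mul, Complex.conj_conj, Complex.conj_ofReal]
              push_cast
              field_simp
      have h2 : ‖φ.toLp 2 μ‖ₑ ^ 2 = LamM f α := by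
        rw [SchwartzMap.toLp, Lp.enorm_toLp, eLpNorm_two_sq, hμ,
          lintegral_weightedMeasure hα (by fun_prop), LamM, hf]
        simp_rw [ofReal_weight]
        rfl
      change ‖inner ℂ (hΦL.toLp Φ) (φ.toLp 2 μ)‖ₑ ^ 2 ≤ c * ‖φ.toLp 2 μ‖ₑ ^ 2
      rw [h1, h2]
      exact h f
  have hfinal := key (hΦL.toLp Φ)
  have hself : ‖inner ℂ (hΦL.toLp Φ) (hΦL.toLp Φ)‖ₑ = ‖hΦL.toLp Φ‖ₑ ^ 2 := by
    rw [inner_self_eq_norm_sq_to_K, enorm_pow, ← ofReal_norm, RCLike.norm_ofReal, abs_norm,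
      ofReal_norm]
  rw [hself, hΦe, sq] at hfinal
  rcases eq_or_ne (fourierEnergy α g) 0 with h0 | h0
  · rw [h0]; exact zero_le
  · exact (ENNReal.mul_le_mul_iff_left h0 hfin).1 hfinal

theorem rieszEnergy_bubble {E : Type*} [NormedAddCommGroup E] [InnerProductSpace ℝ E]
    [MeasurableSpace E] [BorelSpace E] [FiniteDimensional ℝ E] [Nontrivial E] (l : ℝ) :
    rieszEnergy l (bubble (2 * (Module.finrank ℝ E : ℝ) - l) : E → ℝ≥0∞) =
      rieszPotential l (bubble (2 * (Module.finrank ℝ E : ℝ) - l)) (0 : E) *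
        ∫⁻ x : E, bubble (2 * (Module.finrank ℝ E : ℝ)) x := by
  rw [rieszEnergy, ← lintegral_const_mul _ (measurable_bubble _)]
  refine lintegral_congr fun x => ?_
  rw [rieszPotential_bubble, mul_left_comm, bubble_mul, sub_add_cancel]

theorem hlsConst_le_of_forall (hn : 1 ≤ n) {α : Fin m → ℝ}
    (hα : ∀ k, 0 < α k ∧ α k < n) {l : ℝ} (hl : l = ∑ k, ((n : ℝ) - α k)) (hl0 : 0 < l)
    (hln : l < n) {C : ℝ≥0∞} (hC : ∀ f : 𝓢(Fin m → EuclideanSpace ℝ (Fin n), ℂ),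
      (∫⁻ x : EuclideanSpace ℝ (Fin n), ‖f fun _ => x‖ₑ ^ (2 * n / l)) ^ (l / n) ≤
        C * LamM f α) :
    (∏ k, ENNReal.ofReal (rieszGamma n (α k))) * hlsConst (EuclideanSpace ℝ (Fin n)) l ≤ C := by
  rcases eq_or_ne C ∞ with rfl | hCt
  · exact le_top
  have : Nonempty (Fin n) := ⟨⟨0, hn⟩⟩
  have hn0 : (0 : ℝ) < n := by positivity
  have hdim : Module.finrank ℝ (EuclideanSpace ℝ (Fin n)) = n := finrank_euclideanSpace_fin
  set B : ℝ≥0∞ := ∫⁻ x : EuclideanSpace ℝ (Fin n), bubble (2 * (n : ℝ)) x with hB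
  set κ : ℝ≥0∞ := rieszPotential l (bubble (2 * (n : ℝ) - l)) (0 : EuclideanSpace ℝ (Fin n))
    with hκ
  have hBt : B ≠ ∞ := by
    have := lintegral_bubble_two_mul_dim (E := EuclideanSpace ℝ (Fin n))
    rw [hdim] at this
    rw [hB, this]
    exact ENNReal.ofReal_ne_top
  have hB0 : B ≠ 0 := lintegral_bubble_ne_zero _
  have hκt : κ ≠ ∞ := by
    have := rieszPotential_bubble_zero (E := EuclideanSpace ℝ (Fin n)) hl0 (by rwa [hdim])
    rw [hdim] at this
    rw [hκ, this]
    exact ENNReal.ofReal_ne_top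
  set h : EuclideanSpace ℝ (Fin n) → ℝ := fun x => (1 + ‖x‖ ^ 2) ^ (-((2 * n - l) / 2)) with hh
  have hh0 : ∀ x, 0 ≤ h x := fun x => by positivity
  have hhb : ∀ x, ENNReal.ofReal (h x) = bubble (2 * n - l) x := fun x => rfl
  have hhi : Integrable h := by
    have := integrable_rpow_neg_one_add_norm_sq (μ := volume) (E := EuclideanSpace ℝ (Fin n))
      (r := 2 * n - l) (by rw [hdim]; linarith)
    simpa only [neg_div] using this
  have hhc : Integrable fun x => (h x : ℂ) := hhi.ofReal
  have hA : fourierEnergy α (fun x => (h x : ℂ)) =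
      (∏ k, ENNReal.ofReal (rieszGamma n (α k))) * (κ * B) := by
    have h1 := fourierEnergy_ofReal (E := EuclideanSpace ℝ (Fin n)) (β := α) (by rwa [hdim])
      hh0 hhi
    have h2 := rieszEnergy_bubble (E := EuclideanSpace ℝ (Fin n)) l
    rw [hdim] at h1 h2
    rw [h1, ← hl]
    simp_rw [hhb]
    rw [h2]
  have hPt : B ^ ((2 * n - l) / n) ≠ ∞ :=
    ENNReal.rpow_ne_top_of_nonneg (div_nonneg (by linarith) hn0.le) hBt
  have hP0 : B ^ ((2 * n - l) / n) ≠ 0 := (ENNReal.rpow_pos (pos_iff_ne_zero.2 hB0) hBt).ne'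
  have hle : fourierEnergy α (fun x => (h x : ℂ)) ≤ C * B ^ ((2 * n - l) / n) := by
    refine fourierEnergy_le_of_forall (fun k => (hα k).1) hhc ?_
      (ENNReal.mul_ne_top hCt hPt) fun f => ?_
    · rw [hA]
      exact ENNReal.mul_ne_top (ENNReal.prod_ne_top fun k _ => ENNReal.ofReal_ne_top)
        (ENNReal.mul_ne_top hκt hBt)
    · have hpq : (2 * n / l : ℝ).HolderConjugate (2 * n / (2 * n - l)) := by
        refine Real.holderConjugate_iff.2 ⟨?_, ?_⟩
        · rw [lt_div_iff₀ hl0]; linarith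
        · have : 2 * (n : ℝ) - l ≠ 0 := by linarith
          field_simp
          ring
      have hfc : Continuous fun x : EuclideanSpace ℝ (Fin n) => f fun _ => x :=
        f.continuous.comp (by fun_prop)
      have hH := ENNReal.lintegral_mul_le_Lp_mul_Lq volume hpq
        (f := fun x : EuclideanSpace ℝ (Fin n) => ‖f fun _ => x‖ₑ) (g := bubble (2 * n - l))
        (by fun_prop) (measurable_bubble _).aemeasurable
      have hp0 : (0 : ℝ) ≤ 2 * n / (2 * n - l) := div_nonneg (by linarith) (by linarith)
      have hpe : (2 * n - l) * (2 * n / (2 * n - l)) = 2 * (n : ℝ) := by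
        have : 2 * (n : ℝ) - l ≠ 0 := by linarith
        field_simp
      simp_rw [bubble_rpow _ _ hp0, hpe] at hH
      rw [← hB] at hH
      calc ‖∫ x, f (fun _ => x) * (h x : ℂ)‖ₑ ^ 2
          ≤ (∫⁻ x, ‖f fun _ => x‖ₑ * bubble (2 * n - l) x) ^ 2 := by
            refine pow_le_pow_left' ((enorm_integral_le_lintegral_enorm _).trans_eq ?_) 2
            refine lintegral_congr fun x => ?_
            rw [enorm_mul, ← hhb, ← ofReal_norm (h x : ℂ), Complex.norm_real,
              Real.norm_of_nonneg (hh0 x)]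
        _ ≤ _ := pow_le_pow_left' hH 2
        _ = (∫⁻ x : EuclideanSpace ℝ (Fin n), ‖f fun _ => x‖ₑ ^ (2 * n / l)) ^ (l / n) *
              B ^ ((2 * n - l) / n) := by
            rw [mul_pow, ← ENNReal.rpow_natCast, ← ENNReal.rpow_natCast, ← ENNReal.rpow_mul,
              ← ENNReal.rpow_mul]
            congr 2
            · push_cast; field_simp
            · push_cast; field_simp
        _ ≤ C * LamM f α * B ^ ((2 * n - l) / n) := by gcongr; exact hC f
        _ = _ := by ring
  rw [hA] at hle
  rw [← ENNReal.mul_le_mul_iff_left hP0 hPt]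
  refine le_of_eq_of_le ?_ hle
  have hsplit : B ^ (l / n - 1) * B ^ ((2 * n - l) / n) = B := by
    rw [← ENNReal.rpow_add _ _ hB0 hBt]
    conv_rhs => rw [← ENNReal.rpow_one B]
    congr 1
    field_simp
    ring
  rw [hlsConst, hdim, ← hκ, ← hB, mul_assoc, mul_assoc, hsplit]

end LowerBound

theorem hlsConst_euclideanSpace {n : ℕ} (hn : 1 ≤ n) {l : ℝ} (hl0 : 0 < l) (hln : l < n) :
    hlsConst (EuclideanSpace ℝ (Fin n)) l =
      ENNReal.ofReal (π ^ (l / 2) * (Gamma ((n - l) / 2) / Gamma (n - l / 2)) *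
        (Gamma n / Gamma (n / 2)) ^ ((n - l) / n)) := by
  have : Nonempty (Fin n) := ⟨⟨0, hn⟩⟩
  have hn0 : (0 : ℝ) < n := by positivity
  have hdim : Module.finrank ℝ (EuclideanSpace ℝ (Fin n)) = n := finrank_euclideanSpace_fin
  have hG1 : 0 < Gamma ((n : ℝ) / 2) := Gamma_pos_of_pos (by positivity)
  have hG2 : 0 < Gamma (n : ℝ) := Gamma_pos_of_pos hn0
  have hG3 : 0 < Gamma ((n - l) / 2) := Gamma_pos_of_pos (by linarith)
  have hG4 : 0 < Gamma (n - l / 2) := Gamma_pos_of_pos (by linarith)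
  have hB : π ^ ((n : ℝ) / 2) * Gamma ((n : ℝ) / 2) / Gamma n =
      π ^ ((n : ℝ) / 2) * (Gamma n / Gamma ((n : ℝ) / 2))⁻¹ := by
    rw [inv_div, mul_div_assoc]
  rw [hlsConst, rieszPotential_bubble_zero hl0 (by rwa [hdim]), lintegral_bubble_two_mul_dim,
    hdim, ENNReal.ofReal_rpow_of_pos (by positivity), ← ENNReal.ofReal_mul (by positivity), hB,
    Real.mul_rpow (by positivity) (by positivity), ← Real.rpow_mul pi_pos.le,
    Real.inv_rpow (by positivity), ← Real.rpow_neg (by positivity),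
    show (n : ℝ) / 2 * (l / n - 1) = l / 2 - n / 2 by field_simp,
    show -(l / n - 1) = (n - l) / n by field_simp; ring, Real.rpow_sub pi_pos]
  congr 1
  field_simp

theorem prod_rieszGamma {m : ℕ} (d : ℝ) (α : Fin m → ℝ) :
    ∏ k, rieszGamma d (α k) = π ^ (∑ k, α k - m * d / 2) *
      ∏ k, Gamma ((d - α k) / 2) / Gamma (α k / 2) := by
  simp only [rieszGamma, mul_div_assoc]
  rw [Finset.prod_mul_distrib, ← Real.rpow_sum_of_pos pi_pos]
  simp [Finset.sum_sub_distrib]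

/-- **Multilinear Hardy–Littlewood–Sobolev trace inequality, with sharp constant.**
For `0 < α_k < n`, `(m−1)n < α = Σ α_k < mn` and `q = 2n/(mn−α)`,
`(∫ |f(x,…,x)|^q dx)^{2/q} ≤ F_α · Λ(f; α_1,…,α_m)` for all Schwartz `f`,
and `F_α` is the least such constant. -/
theorem stmt8 (m n : ℕ) (hm : 1 ≤ m) (hn : 1 ≤ n)
    (α : Fin m → ℝ) (hα : ∀ k, 0 < α k ∧ α k < n)
    (hlow : ((m : ℝ) - 1) * n < ∑ k, α k) (hhigh : (∑ k, α k) < m * n)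
    (q : ℝ) (hq : q = 2 * n / ((m : ℝ) * n - ∑ k, α k))
    (Fα : ℝ)
    (hFα : Fα = Real.pi ^ ((∑ k, α k) / 2) *
      (∏ k, Real.Gamma (((n : ℝ) - α k) / 2) / Real.Gamma (α k / 2)) *
      (Real.Gamma (((∑ k, α k) - ((m : ℝ) - 1) * n) / 2) /
        Real.Gamma ((n : ℝ) - ((m : ℝ) * n - ∑ k, α k) / 2)) *
      (Real.Gamma (n : ℝ) / Real.Gamma ((n : ℝ) / 2)) ^
        (((∑ k, α k) - ((m : ℝ) - 1) * n) / n)) :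
    IsLeast {C : ℝ≥0∞ |
        ∀ f : SchwartzMap (Fin m → EuclideanSpace ℝ (Fin n)) ℂ,
          (∫⁻ x : EuclideanSpace ℝ (Fin n), (‖f (fun _ => x)‖₊ : ℝ≥0∞) ^ q) ^ (2 / q) ≤
            C * LamM (fun x => f x) α}
      (ENNReal.ofReal Fα) := by
  have hn0 : (0 : ℝ) < n := by positivity
  set l : ℝ := (m : ℝ) * n - ∑ k, α k with hl
  have hls : l = ∑ k, ((n : ℝ) - α k) := by simp [hl, Finset.sum_sub_distrib]
  have hl0 : 0 < l := by linarith
  have hln : l < n := by linarith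
  have h2q : 2 / q = l / n := by rw [hq]; field_simp
  have hF : ENNReal.ofReal Fα = (∏ k, ENNReal.ofReal (rieszGamma n (α k))) *
      hlsConst (EuclideanSpace ℝ (Fin n)) l := by
    have hγ : ∀ k, 0 ≤ rieszGamma n (α k) := fun k => (rieszGamma_pos (hα k).1 (hα k).2).le
    rw [hlsConst_euclideanSpace hn hl0 hln, ← ENNReal.ofReal_prod_of_nonneg fun k _ => hγ k,
      ← ENNReal.ofReal_mul (Finset.prod_nonneg fun k _ => hγ k), prod_rieszGamma, hFα,
      show (∑ k, α k) - ((m : ℝ) - 1) * n = n - l by rw [hl]; ring,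
      show (∑ k, α k) / 2 = (∑ k, α k - m * n / 2) + l / 2 by rw [hl]; ring,
      Real.rpow_add pi_pos]
    congr 1
    ring
  rw [hF, h2q, hq]
  exact ⟨fun f => lintegral_diagonal_rpow_le hm hn hα hls hl0 hln f,
    fun C hC => hlsConst_le_of_forall hn hα hls hl0 hln hC⟩
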